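/- arXiv:1609.09487 — 4 statements merged into one kernel-verified Lean document; each statement's English description precedes it below -/
import Mathlib

section
/- Let ρ be a CJ channel operator from A to k outputs B_1,…,B_k (indexed by (Π i, β i) × a) such that for every i, the quantum conditional mutual information I(B_i : B̄_i | A), evaluated on ρ̂ := (1 / card a) · ρ with grouping (β i, Π_{j≠i} β j, a), equals 0. Then there exist a finite type ι, natural numbers m i j (for i : ι, j : Fin k) with Σ_i Π_j (m i j) = card a, a unitary matrix V from index type a to the sigma type Σ i, (Π j, Fin (m i j)), and for each i and j a CJ channel operator ρ^i_j indexed by β j × Fin (m i j) (positive semidefinite with partial trace over β j equal to the identity), such that the conjugation of ρ on its a-indices by V is block diagonal in i and on block i equals the tensor product ⊗_j ρ^i_j, i.e. its entries on block i are Π_j ρ^i_j((v j, μ j),(w j, ν j)). (Theorem 4, implication from condition 3 to condition 4.) -/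
open Matrix BigOperators
open scoped ComplexOrder

noncomputable section

/-- Partial trace over the first tensor factor. -/
def ptrace₁ {α β : Type*} [Fintype α] (M : Matrix (α × β) (α × β) ℂ) : Matrix β β ℂ :=
  Matrix.of fun j j' => ∑ i, M (i, j) (i, j')

/-- Partial trace over the second tensor factor. -/
def ptrace₂ {α β : Type*} [Fintype β] (M : Matrix (α × β) (α × β) ℂ) : Matrix α α ℂ :=
  Matrix.of fun i i' => ∑ j, M (i, j) (i', j)

/-- `M` is a Choi–Jamiołkowski channel operator from `a` to `b`: positive semidefinite with
partial trace over the output equal to the identity. -/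
def IsCJChannel {b a : Type*} [Fintype b] [Fintype a] [DecidableEq a]
    (M : Matrix (b × a) (b × a) ℂ) : Prop :=
  M.PosSemidef ∧ ptrace₁ M = 1

/-- The marginal `ρ_{B|A}` of a channel operator `ρ_{BC|A}` (partial trace over `C`). -/
def margB {b c a : Type*} [Fintype c] (ρ : Matrix ((b × c) × a) ((b × c) × a) ℂ) :
    Matrix (b × a) (b × a) ℂ :=
  Matrix.of fun p q => ∑ γ, ρ ((p.1, γ), p.2) ((q.1, γ), q.2)

/-- The marginal `ρ_{C|A}` of a channel operator `ρ_{BC|A}` (partial trace over `B`). -/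
def margC {b c a : Type*} [Fintype b] (ρ : Matrix ((b × c) × a) ((b × c) × a) ℂ) :
    Matrix (c × a) (c × a) ℂ :=
  Matrix.of fun p q => ∑ β, ρ ((β, p.1), p.2) ((β, q.1), q.2)

/-- Extension `↑ρ_{B|A}` of a marginal to the full space, tensoring with the identity on `C`. -/
def extB {b c a : Type*} [DecidableEq c] (M : Matrix (b × a) (b × a) ℂ) :
    Matrix ((b × c) × a) ((b × c) × a) ℂ :=
  Matrix.of fun p q => M (p.1.1, p.2) (q.1.1, q.2) * (if p.1.2 = q.1.2 then 1 else 0)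

/-- Extension `↑ρ_{C|A}` of a marginal to the full space, tensoring with the identity on `B`. -/
def extC {b c a : Type*} [DecidableEq b] (M : Matrix (c × a) (c × a) ℂ) :
    Matrix ((b × c) × a) ((b × c) × a) ℂ :=
  Matrix.of fun p q => M (p.1.2, p.2) (q.1.2, q.2) * (if p.1.1 = q.1.1 then 1 else 0)

/-- The Choi–Jamiołkowski operator of a (unitary) matrix `U`. -/
def cjOf {y x : Type*} (U : Matrix y x ℂ) : Matrix (y × x) (y × x) ℂ :=
  Matrix.of fun p q => U p.1 p.2 * star (U q.1 q.2)

/-- A (possibly rectangular-typed) matrix is unitary if both `U Uᴴ = 1` and `Uᴴ U = 1`. -/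
def IsUnitaryMat {y x : Type*} [Fintype y] [Fintype x] [DecidableEq y] [DecidableEq x]
    (U : Matrix y x ℂ) : Prop :=
  U * Uᴴ = 1 ∧ Uᴴ * U = 1

/-- von Neumann entropy of a matrix (junk value `0` if not Hermitian);
`Real.log 0 = 0` gives the usual convention `0 log 0 = 0`. -/
def vNEntropy {n : Type*} [Fintype n] (M : Matrix n n ℂ) : ℝ :=
  letI := Classical.decEq n
  if h : M.IsHermitian then -∑ i, h.eigenvalues i * Real.log (h.eigenvalues i) else 0

/-- Quantum conditional mutual information `I(B:C|A)` of a matrix on `(b × c) × a`,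
with systems grouped as `B`, `C`, `A`. -/
def qcmiBCA {b c a : Type*} [Fintype b] [Fintype c] [Fintype a]
    (ρ : Matrix ((b × c) × a) ((b × c) × a) ℂ) : ℝ :=
  vNEntropy (margB ρ) + vNEntropy (margC ρ) - vNEntropy ρ - vNEntropy (ptrace₁ ρ)

/-- Conjugation of `ρ` on its `A` indices by a matrix `V` from `a` to `σa`. -/
def conjOnA {o σa a : Type*} [Fintype a] (ρ : Matrix (o × a) (o × a) ℂ)
    (V : Matrix σa a ℂ) : Matrix (o × σa) (o × σa) ℂ :=
  Matrix.of fun p q => ∑ x : a, ∑ x' : a, V p.2 x * ρ (p.1, x) (q.1, x') * star (V q.2 x')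

section
variable {k : ℕ} {β : Fin k → Type*} {a : Type*}
  [∀ i, Fintype (β i)] [∀ i, DecidableEq (β i)] [∀ i, Nonempty (β i)]
  [Fintype a] [DecidableEq a] [Nonempty a]

/-- Insert the value `x` at coordinate `i` of a family defined away from `i`. -/
def insertAt (i : Fin k) (x : β i) (g : ∀ j : {j : Fin k // j ≠ i}, β j.1) : ∀ j, β j :=
  fun j => if h : j = i then cast (congrArg β h).symm x else g ⟨j, h⟩

/-- The marginal `ρ_{B_i|A}`: partial trace over all output factors `j ≠ i`. -/
def margOut (i : Fin k) (ρ : Matrix ((∀ j, β j) × a) ((∀ j, β j) × a) ℂ) :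
    Matrix (β i × a) (β i × a) ℂ :=
  Matrix.of fun p q => ∑ g : ∀ j : {j : Fin k // j ≠ i}, β j.1,
    ρ (insertAt i p.1 g, p.2) (insertAt i q.1 g, q.2)

/-- The marginal `ρ_{B̄_i|A}`: partial trace over output factor `i`. -/
def margRest (i : Fin k) (ρ : Matrix ((∀ j, β j) × a) ((∀ j, β j) × a) ℂ) :
    Matrix ((∀ j : {j : Fin k // j ≠ i}, β j.1) × a)
      ((∀ j : {j : Fin k // j ≠ i}, β j.1) × a) ℂ :=
  Matrix.of fun p q => ∑ x : β i, ρ (insertAt i x p.1, p.2) (insertAt i x q.1, q.2)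

/-- Extension `↑ρ_{B_i|A}` of a marginal to the full output space, tensoring with the
identity on all output factors `j ≠ i`. -/
def extOut (i : Fin k) (M : Matrix (β i × a) (β i × a) ℂ) :
    Matrix ((∀ j, β j) × a) ((∀ j, β j) × a) ℂ :=
  Matrix.of fun p q => M (p.1 i, p.2) (q.1 i, q.2) *
    ∏ j ∈ Finset.univ.erase i, (if p.1 j = q.1 j then (1 : ℂ) else 0)

/-- Quantum conditional mutual information `I(B_i : B̄_i | A)` of a matrix on
`(Π j, β j) × a`, with systems grouped as `B_i`, `Π_{j ≠ i} B_j`, `A`. -/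
def qcmiOut (i : Fin k) (ρ : Matrix ((∀ j, β j) × a) ((∀ j, β j) × a) ℂ) : ℝ :=
  vNEntropy (margOut i ρ) + vNEntropy (margRest i ρ) - vNEntropy ρ - vNEntropy (ptrace₁ ρ)

/-- A multipartite common-cause block form for a channel operator from `A` to
`B_1, …, B_k`: a unitary decomposition of the input space as a direct sum of `k`-fold
tensor products, with the channel factorizing blockwise into `k` channels. -/
structure MultiBlockForm (ρ : Matrix ((∀ j, β j) × a) ((∀ j, β j) × a) ℂ) where
  ι : Type
  [fintι : Fintype ι]
  [deceqι : DecidableEq ι]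
  m : ι → Fin k → ℕ
  card_eq : ∑ i : ι, ∏ j, m i j = Fintype.card a
  V : Matrix (Σ i : ι, ∀ j, Fin (m i j)) a ℂ
  hV : IsUnitaryMat V
  ρc : ∀ (i : ι) (j : Fin k), Matrix (β j × Fin (m i j)) (β j × Fin (m i j)) ℂ
  hρc : ∀ i j, (ρc i j).PosSemidef ∧ ptrace₁ (ρc i j) = 1
  offdiag : ∀ (v w : ∀ j, β j) (s t : Σ i : ι, ∀ j, Fin (m i j)), s.1 ≠ t.1 →
    conjOnA ρ V (v, s) (w, t) = 0
  diag : ∀ (i : ι) (μ ν : ∀ j, Fin (m i j)) (v w : ∀ j, β j),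
    conjOnA ρ V (v, ⟨i, μ⟩) (w, ⟨i, ν⟩) = ∏ j, ρc i j (v j, μ j) (w j, ν j)

end

set_option linter.unusedSectionVars false

theorem mul_eq_zero_of_re_trace_eq_zero {n : Type*} [Fintype n]
    {Z : Matrix n n ℂ} (h : (trace (Zᴴ * Z)).re = 0) : Z = 0 := by
  have h1 := (Matrix.posSemidef_conjTranspose_mul_self Z).trace_nonneg
  rw [Complex.nonneg_iff] at h1
  exact Matrix.trace_conjTranspose_mul_self_eq_zero_iff.1 (Complex.ext h (h1.2.symm))

section
variable {n ι κ l : Type*} [Fintype n] [DecidableEq n]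

theorem re_trace_quadratic {P Q K : Matrix n n ℂ} (hP : P.IsHermitian) (hP2 : P * P = P)
    (hQ : Q.IsHermitian) (hQ2 : Q * Q = Q) (hK : K.IsHermitian) (p e : ℝ) :
    (trace ((Q * ((p : ℂ) • 1 - (e : ℂ) • K) * P)ᴴ * (Q * ((p : ℂ) • 1 - (e : ℂ) • K) * P))).re
      = p ^ 2 * (trace (P * Q)).re - 2 * p * e * (trace (P * Q * K)).re
        + e ^ 2 * (trace (P * K * Q * K)).re := by
  have h1 : (Q * ((p : ℂ) • 1 - (e : ℂ) • K) * P)ᴴ * (Q * ((p : ℂ) • 1 - (e : ℂ) • K) * P)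
      = P * ((p : ℂ) • 1 - (e : ℂ) • K) * Q * ((p : ℂ) • 1 - (e : ℂ) • K) * P := by
    simp only [conjTranspose_mul, conjTranspose_sub, conjTranspose_smul, conjTranspose_one,
      hP.eq, hQ.eq, hK.eq, Complex.star_def, Complex.conj_ofReal]
    calc _ = P * ((p : ℂ) • 1 - (e : ℂ) • K) * (Q * Q) * ((p : ℂ) • 1 - (e : ℂ) • K) * P := by
          noncomm_ring
      _ = _ := by rw [hQ2]
  rw [h1, trace_mul_comm, ← Matrix.mul_assoc, ← Matrix.mul_assoc, ← Matrix.mul_assoc, hP2]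
  have h2 : P * ((p : ℂ) • 1 - (e : ℂ) • K) * Q * ((p : ℂ) • 1 - (e : ℂ) • K)
      = ((p ^ 2 : ℝ) : ℂ) • (P * Q) - ((p * e : ℝ) : ℂ) • (P * Q * K)
        - ((p * e : ℝ) : ℂ) • (P * K * Q) + ((e ^ 2 : ℝ) : ℂ) • (P * K * Q * K) := by
    simp only [mul_sub, sub_mul, Matrix.mul_smul, Matrix.smul_mul, Matrix.mul_one,
      smul_smul]
    push_cast
    module
  have h3 : (trace (P * K * Q)).re = (trace (P * Q * K)).re := by
    have : (P * K * Q)ᴴ = Q * K * P := by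
      simp [conjTranspose_mul, hP.eq, hQ.eq, hK.eq, Matrix.mul_assoc]
    have h4 : trace (P * Q * K) = star (trace (P * K * Q)) := by
      rw [← trace_conjTranspose, this, Matrix.mul_assoc P Q K, trace_mul_comm P]
    rw [h4]; simp
  rw [h2]
  simp only [trace_add, trace_sub, trace_smul, smul_eq_mul, Complex.add_re, Complex.sub_re,
    Complex.re_ofReal_mul, h3]
  ring

theorem re_trace_conjTranspose_mul_self_nonneg (Z : Matrix n n ℂ) :
    0 ≤ (trace (Zᴴ * Z)).re :=
  (Complex.nonneg_iff.1 (Matrix.posSemidef_conjTranspose_mul_self Z).trace_nonneg).1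

variable [Fintype ι] [Fintype κ] [Fintype l]

/-- A resolution of the identity into orthogonal projections indexed by `ι`. -/
structure IsProjResolution [DecidableEq ι] (P : ι → Matrix n n ℂ) : Prop where
  herm : ∀ i, (P i).IsHermitian
  mul : ∀ i j, P i * P j = if i = j then P i else 0
  sum : ∑ i, P i = 1

theorem IsProjResolution.idem [DecidableEq ι] {P : ι → Matrix n n ℂ} (h : IsProjResolution P)
    (i : ι) : P i * P i = P i := by simp [h.mul]

theorem IsProjResolution.sum_mul_sum [DecidableEq ι] {P : ι → Matrix n n ℂ}
    (h : IsProjResolution P) (x y : ι → ℝ) :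
    (∑ i, (x i : ℂ) • P i) * (∑ i, (y i : ℂ) • P i) = ∑ i, ((x i * y i : ℝ) : ℂ) • P i := by
  simp only [Finset.sum_mul, Finset.mul_sum, Matrix.smul_mul, Matrix.mul_smul, h.mul, smul_smul,
    smul_ite, smul_zero, Complex.ofReal_mul]
  simp [mul_comm]

theorem IsProjResolution.isHermitian_sum [DecidableEq ι] {P : ι → Matrix n n ℂ}
    (h : IsProjResolution P) (x : ι → ℝ) : (∑ i, (x i : ℂ) • P i).IsHermitian := by
  simp [IsHermitian, conjTranspose_sum, (h.herm _).eq]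

/-- Scalar core of the equality case of strong subadditivity: a function of the form
`∑ q log (s + x p) - ∑ t log (c + x t) + C` vanishing at `0` and at infinity and whose
derivative is nonnegative has vanishing derivative at `0`. -/
theorem deriv_at_zero_eq_zero [DecidableEq ι] (p : ι → ℝ) (s : κ → ℝ) (t : l → ℝ)
    (w : ι → κ → ℝ) (c : ℝ)
    (hc : 0 < c) (hp : ∀ i, 0 ≤ p i) (hs : ∀ j, 0 ≤ s j) (ht : ∀ k, 0 ≤ t k)
    (hw : ∀ i j, 0 ≤ w i j) (hw1 : ∀ i, ∑ j, w i j = 1) (hws : ∀ j, ∑ i, p i * w i j = s j)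
    (htot : ∑ i, p i = ∑ k, t k)
    (hent : ∑ i, p i * Real.log (p i) + (∑ k, t k) * Real.log c
      = ∑ j, s j * Real.log (s j) + ∑ k, t k * Real.log (t k))
    (hder : ∀ x : ℝ, 0 ≤ x → ∑ k, t k ^ 2 / (c + x * t k)
      ≤ ∑ i, ∑ j, p i ^ 2 * w i j / (s j + x * p i)) :
    ∑ i, ∑ j, p i ^ 2 * w i j / s j = ∑ k, t k ^ 2 / c := by
  have hz : ∀ i j, s j = 0 → p i * w i j = 0 := fun i j h => by
    have := hws j
    rw [h, Finset.sum_eq_zero_iff_of_nonneg (fun i _ => mul_nonneg (hp i) (hw i j))] at this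
    exact this i (Finset.mem_univ i)
  set g : ℝ → ℝ := fun x => ∑ i, ∑ j, p i * w i j * Real.log (s j + x * p i)
    - ∑ k, t k * Real.log (c + x * t k)
    - ∑ i, p i * Real.log (p i) + ∑ k, t k * Real.log (t k) with hg
  set g' : ℝ → ℝ := fun x => ∑ i, ∑ j, p i ^ 2 * w i j / (s j + x * p i)
    - ∑ k, t k ^ 2 / (c + x * t k) with hg'
  have hderiv : ∀ x, 0 ≤ x → HasDerivAt g (g' x) x := by
    intro x hx
    have h1 : ∀ i j, HasDerivAt (fun x => p i * w i j * Real.log (s j + x * p i))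
        (p i ^ 2 * w i j / (s j + x * p i)) x := by
      intro i j
      rcases eq_or_ne (p i * w i j) 0 with h | h
      · have : p i ^ 2 * w i j = 0 := by rw [sq, mul_assoc, h, mul_zero]
        simpa [h, this] using hasDerivAt_const x (0 : ℝ)
      · have hsj : 0 < s j := lt_of_le_of_ne (hs j) fun h' => h (hz i j h'.symm)
        have hpos : 0 < s j + x * p i := by have := mul_nonneg hx (hp i); linarith
        have h2 : HasDerivAt (fun x => s j + x * p i) (p i) x := by
          simpa using ((hasDerivAt_id x).mul_const (p i)).const_add (s j)
        exact ((h2.log hpos.ne').const_mul (p i * w i j)).congr_deriv (by ring)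
    have h3 : ∀ k, HasDerivAt (fun x => t k * Real.log (c + x * t k))
        (t k ^ 2 / (c + x * t k)) x := by
      intro k
      have hpos : 0 < c + x * t k := by have := mul_nonneg hx (ht k); linarith
      have h2 : HasDerivAt (fun x => c + x * t k) (t k) x := by
        simpa using ((hasDerivAt_id x).mul_const (t k)).const_add c
      exact ((h2.log hpos.ne').const_mul (t k)).congr_deriv (by ring)
    exact (((HasDerivAt.fun_sum fun i _ => HasDerivAt.fun_sum fun j _ => h1 i j).sub
      (HasDerivAt.fun_sum fun k _ => h3 k)).sub_const _).add_const _
  have hmono : MonotoneOn g (Set.Ici 0) := by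
    apply monotoneOn_of_hasDerivWithinAt_nonneg (convex_Ici 0) (f' := g')
    · exact fun x hx => (hderiv x hx).continuousAt.continuousWithinAt
    · intro x hx
      exact (hderiv x (interior_subset hx)).hasDerivWithinAt
    · intro x hx
      exact sub_nonneg.2 (hder x (interior_subset hx))
  have hg0 : g 0 = 0 := by
    have h1 : ∑ i, ∑ j, p i * w i j * Real.log (s j) = ∑ j, s j * Real.log (s j) := by
      rw [Finset.sum_comm]
      exact Finset.sum_congr rfl fun j _ => by rw [← Finset.sum_mul, hws]
    simp only [hg, zero_mul, add_zero, h1, ← Finset.sum_mul]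
    linarith
  have hbound : ∀ x, 0 < x → g x ≤ (∑ i, ∑ j, w i j * s j) * x⁻¹ := by
    intro x hx
    have h1 : ∀ i j, p i * w i j * Real.log (s j + x * p i)
        ≤ p i * w i j * Real.log x + w i j * (p i * Real.log (p i)) + w i j * s j * x⁻¹ := by
      intro i j
      rcases (hp i).eq_or_lt with h | h
      · simp [← h]; have := hw i j; have := hs j; positivity
      · have hl : Real.log (s j + x * p i) ≤ Real.log x + Real.log (p i) + s j / (x * p i) := by
          have hxp : 0 < x * p i := mul_pos hx h
          have h5 : s j + x * p i = (x * p i) * (1 + s j / (x * p i)) := by field_simp; ring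
          have h6 : 0 < 1 + s j / (x * p i) := by have := hs j; positivity
          rw [h5, Real.log_mul hxp.ne' h6.ne', Real.log_mul hx.ne' h.ne']
          have := Real.log_le_sub_one_of_pos h6
          linarith
        calc _ ≤ p i * w i j * (Real.log x + Real.log (p i) + s j / (x * p i)) :=
              mul_le_mul_of_nonneg_left hl (mul_nonneg (hp i) (hw i j))
          _ = _ := by field_simp
    have h2 : ∀ k, t k * Real.log x + t k * Real.log (t k) ≤ t k * Real.log (c + x * t k) := by
      intro k
      rcases (ht k).eq_or_lt with h | h
      · simp [← h]
      · rw [← mul_add, ← Real.log_mul hx.ne' h.ne']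
        exact mul_le_mul_of_nonneg_left
          (Real.log_le_log (mul_pos hx h) (by linarith)) (ht k)
    have h3 := Finset.sum_le_sum fun i (_ : i ∈ Finset.univ) =>
      Finset.sum_le_sum fun j (_ : j ∈ Finset.univ) => h1 i j
    have h4 := Finset.sum_le_sum fun k (_ : k ∈ Finset.univ) => h2 k
    simp only [Finset.sum_add_distrib, ← Finset.sum_mul, ← Finset.mul_sum, hw1, mul_one,
      one_mul] at h3 h4
    rw [htot] at h3
    simp only [hg]
    linarith
  have hzero : ∀ x, 0 ≤ x → g x = 0 := by
    intro x hx
    refine le_antisymm ?_ (hg0 ▸ hmono (Set.mem_Ici.2 le_rfl) hx hx)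
    have hlim : Filter.Tendsto (fun y : ℝ => (∑ i, ∑ j, w i j * s j) * y⁻¹)
        Filter.atTop (nhds 0) := by
      simpa using tendsto_inv_atTop_zero.const_mul (∑ i, ∑ j, w i j * s j)
    refine ge_of_tendsto hlim ?_
    filter_upwards [Filter.eventually_ge_atTop x, Filter.eventually_gt_atTop 0] with y hy hy0
    exact (hmono hx hy0.le hy).trans (hbound y hy0)
  have h1 : HasDerivWithinAt g (g' 0) (Set.Ici 0) 0 := (hderiv 0 le_rfl).hasDerivWithinAt
  have h2 : HasDerivWithinAt g 0 (Set.Ici 0) 0 :=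
    (hasDerivWithinAt_const 0 (Set.Ici 0) (0 : ℝ)).congr (fun x hx => hzero x hx) hg0
  have h3 : g' 0 = 0 := (uniqueDiffWithinAt_Ici (0:ℝ)).eq_deriv _ h1 h2
  simpa [hg', sub_eq_zero] using h3

/-- Equality case of strong subadditivity relative to a maximally mixed conditioning system,
formulated through spectral resolutions. -/
theorem smul_eq_mul_of_entropy_eq [DecidableEq ι] [DecidableEq κ] [DecidableEq l]
    {p : ι → ℝ} {s : κ → ℝ} {t : l → ℝ}
    {P : ι → Matrix n n ℂ} {Q : κ → Matrix n n ℂ} {R : l → Matrix n n ℂ}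
    (hP : IsProjResolution P) (hQ : IsProjResolution Q) (hR : IsProjResolution R)
    {c : ℝ} (hc : 0 < c) (hp : ∀ i, 0 ≤ p i) (hs : ∀ j, 0 ≤ s j) (ht : ∀ k, 0 ≤ t k)
    (hP1 : ∀ i, trace (P i) = 1)
    (hPQ : ∀ j, trace ((∑ i, (p i : ℂ) • P i) * Q j) = s j)
    (hPR : ∀ k, trace ((∑ i, (p i : ℂ) • P i) * R k) = t k)
    (hQR : ∀ k, trace ((∑ j, (s j : ℂ) • Q j) * R k) = c)
    (hent : ∑ i, p i * Real.log (p i) + (∑ k, t k) * Real.log c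
      = ∑ j, s j * Real.log (s j) + ∑ k, t k * Real.log (t k)) :
    (c : ℂ) • ∑ i, (p i : ℂ) • P i = (∑ j, (s j : ℂ) • Q j) * ∑ k, (t k : ℂ) • R k := by
  set ρ := ∑ i, (p i : ℂ) • P i with hρ
  set σ := ∑ j, (s j : ℂ) • Q j with hσ
  set w : ι → κ → ℝ := fun i j => (trace (P i * Q j)).re with hwdef
  have hw : ∀ i j, 0 ≤ w i j := fun i j => by
    have := re_trace_conjTranspose_mul_self_nonneg (Q j * P i)
    rwa [conjTranspose_mul, (hP.herm i).eq, (hQ.herm j).eq, Matrix.mul_assoc,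
      ← Matrix.mul_assoc (Q j), hQ.idem, ← Matrix.mul_assoc, trace_mul_comm, ← Matrix.mul_assoc,
      hP.idem] at this
  have hw1 : ∀ i, ∑ j, w i j = 1 := fun i => by
    simp only [hwdef, ← Complex.re_sum, ← trace_sum, ← Finset.mul_sum, hQ.sum, Matrix.mul_one, hP1,
      Complex.one_re]
  have hws : ∀ j, ∑ i, p i * w i j = s j := fun j => by
    have := congrArg Complex.re (hPQ j)
    simpa [hρ, Finset.sum_mul, trace_sum] using this
  have hρ1 : trace ρ = ∑ i, (p i : ℂ) := by simp [hρ, trace_sum, hP1]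
  have hρ2 : trace ρ = ∑ k, (t k : ℂ) := by
    rw [← Finset.sum_congr rfl fun k _ => hPR k, ← trace_sum, ← Finset.mul_sum, hR.sum,
      Matrix.mul_one]
  have htot : ∑ i, p i = ∑ k, t k := by exact_mod_cast hρ1.symm.trans hρ2
  have hws0 : ∀ i j, s j = 0 → p i * w i j = 0 := fun i j h => by
    have := hws j
    rw [h, Finset.sum_eq_zero_iff_of_nonneg (fun i _ => mul_nonneg (hp i) (hw i j))] at this
    exact this i (Finset.mem_univ i)
  have hdata : ∀ k : l → ℝ, ∃ X Y : ι → κ → ℝ,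
      (∀ i j (e : ℝ), (trace ((Q j * ((p i : ℂ) • 1 - (e : ℂ) • ∑ m, (k m : ℂ) • R m) * P i)ᴴ
        * (Q j * ((p i : ℂ) • 1 - (e : ℂ) • ∑ m, (k m : ℂ) • R m) * P i))).re
        = p i ^ 2 * w i j - 2 * p i * e * X i j + e ^ 2 * Y i j) ∧
      (∀ i j, w i j = 0 → X i j = 0) ∧
      ∑ i, ∑ j, p i * X i j = ∑ m, k m * t m ∧
      ∑ i, ∑ j, p i * Y i j = ∑ m, k m * k m * t m ∧
      ∑ i, ∑ j, s j * Y i j = ∑ m, k m * k m * c := by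
    intro k
    have hK := hR.isHermitian_sum k
    have hKK := hR.sum_mul_sum k k
    have hKρ : trace (ρ * ∑ m, (k m : ℂ) • R m) = ∑ m, (k m : ℂ) * t m := by
      simp [Finset.mul_sum, trace_sum, hPR]
    have hKKρ : trace (ρ * ∑ m, ((k m * k m : ℝ) : ℂ) • R m) = ∑ m, (k m * k m : ℂ) * t m := by
      simp [Finset.mul_sum, trace_sum, hPR]
    have hKKσ : trace (σ * ∑ m, ((k m * k m : ℝ) : ℂ) • R m) = ∑ m, (k m * k m : ℂ) * c := by
      simp [Finset.mul_sum, trace_sum, hQR]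
    set K := ∑ m, (k m : ℂ) • R m
    refine ⟨fun i j => (trace (P i * Q j * K)).re, fun i j => (trace (P i * K * Q j * K)).re,
      fun i j e => re_trace_quadratic (hP.herm i) (hP.idem i) (hQ.herm j) (hQ.idem j) hK (p i) e,
      fun i j h => ?_, ?_, ?_, ?_⟩
    · have : Q j * P i = 0 := by
        apply mul_eq_zero_of_re_trace_eq_zero
        rw [conjTranspose_mul, (hP.herm i).eq, (hQ.herm j).eq, Matrix.mul_assoc,
          ← Matrix.mul_assoc (Q j), hQ.idem, ← Matrix.mul_assoc, trace_mul_comm,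
          ← Matrix.mul_assoc, hP.idem]
        exact h
      have h2 : P i * Q j = 0 := by
        simpa [conjTranspose_mul, (hP.herm i).eq, (hQ.herm j).eq] using
          congrArg conjTranspose this
      simp [h2]
    · have h1 : ∀ i, ∑ j, p i * (trace (P i * Q j * K)).re
          = (trace ((p i : ℂ) • P i * K)).re := fun i => by
        rw [← Finset.mul_sum, ← Complex.re_sum, ← trace_sum, ← Finset.sum_mul, ← Finset.mul_sum,
          hQ.sum, Matrix.mul_one, Matrix.smul_mul, trace_smul, smul_eq_mul, Complex.re_ofReal_mul]
      rw [Finset.sum_congr rfl fun i _ => h1 i, ← Complex.re_sum, ← trace_sum, ← Finset.sum_mul,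
        hKρ]
      simp
    · have h1 : ∀ i, ∑ j, p i * (trace (P i * K * Q j * K)).re
          = (trace ((p i : ℂ) • P i * (K * K))).re := fun i => by
        rw [← Finset.mul_sum, ← Complex.re_sum, ← trace_sum, ← Finset.sum_mul, ← Finset.mul_sum,
          hQ.sum, Matrix.mul_one, Matrix.mul_assoc, Matrix.smul_mul, trace_smul,
          smul_eq_mul, Complex.re_ofReal_mul]
      rw [Finset.sum_congr rfl fun i _ => h1 i, ← Complex.re_sum, ← trace_sum, ← Finset.sum_mul,
        hKK, hKKρ]
      simp
    · rw [Finset.sum_comm]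
      have h1 : ∀ j, ∑ i, s j * (trace (P i * K * Q j * K)).re
          = (trace ((s j : ℂ) • Q j * (K * K))).re := fun j => by
        rw [← Finset.mul_sum, ← Complex.re_sum, ← trace_sum, ← Finset.sum_mul, ← Finset.sum_mul,
          ← Finset.sum_mul, hP.sum, Matrix.one_mul, Matrix.mul_assoc, trace_mul_comm,
          Matrix.mul_assoc, Matrix.smul_mul, trace_smul, smul_eq_mul,
          Complex.re_ofReal_mul]
      rw [Finset.sum_congr rfl fun i _ => h1 i, ← Complex.re_sum, ← trace_sum, ← Finset.sum_mul,
        hKK, hKKσ]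
      simp
  have hterm : ∀ (x p s w X Y S : ℝ), 0 ≤ S → S = p ^ 2 * w - 2 * p * (s + x * p) * X
      + (s + x * p) ^ 2 * Y → 0 ≤ s → 0 ≤ p → 0 ≤ x → (s = 0 → p * w = 0) → (w = 0 → X = 0) →
      0 ≤ p ^ 2 * w / (s + x * p) - 2 * (p * X) + (s * Y + x * (p * Y)) := by
    intro x p s w X Y S hS hSe hs hp hx h0 hX
    have h1 : 0 ≤ s + x * p := add_nonneg hs (mul_nonneg hx hp)
    rcases h1.eq_or_lt with h | h
    · have hxp := mul_nonneg hx hp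
      have hs' : s = 0 := by linarith
      have hxp' : x * p = 0 := by linarith
      have hpX : p * X = 0 := by
        rcases mul_eq_zero.1 (h0 hs') with h | h
        · simp [h]
        · simp [hX h]
      rw [← h, hpX, hs', ← mul_assoc x, hxp']
      simp
    · rw [hSe] at hS
      refine (div_nonneg hS h.le).trans_eq ?_
      rw [show s * Y + x * (p * Y) = (s + x * p) * Y by ring]
      generalize s + x * p = e at h
      field_simp
  have hsum : ∀ (x : ℝ) (k : l → ℝ) (X Y : ι → κ → ℝ),
      ∑ i, ∑ j, p i * X i j = ∑ m, k m * t m →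
      ∑ i, ∑ j, p i * Y i j = ∑ m, k m * k m * t m →
      ∑ i, ∑ j, s j * Y i j = ∑ m, k m * k m * c →
      ∑ i, ∑ j, (p i ^ 2 * w i j / (s j + x * p i) - 2 * (p i * X i j)
        + (s j * Y i j + x * (p i * Y i j))) = ∑ i, ∑ j, p i ^ 2 * w i j / (s j + x * p i)
        - ∑ m, (2 * (k m * t m) - (k m * k m * c + x * (k m * k m * t m))) := by
    intro x k X Y h1 h2 h3
    rw [Finset.sum_sub_distrib, Finset.sum_add_distrib, ← Finset.mul_sum, ← Finset.mul_sum,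
      ← h1, ← h2, ← h3]
    simp only [Finset.sum_add_distrib, Finset.sum_sub_distrib, Finset.mul_sum]
    ring
  have key := deriv_at_zero_eq_zero p s t w c hc hp hs ht hw hw1 hws htot hent (by
    intro x hx0
    obtain ⟨X, Y, hq, hX0, h1, h2, h3⟩ := hdata fun m => t m / (c + x * t m)
    have h4 := Finset.sum_nonneg fun i (_ : i ∈ Finset.univ) =>
      Finset.sum_nonneg fun j (_ : j ∈ Finset.univ) => hterm x (p i) (s j) (w i j) (X i j) (Y i j)
        _ (re_trace_conjTranspose_mul_self_nonneg _) (hq i j _) (hs j) (hp i) hx0 (hws0 i j)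
        (hX0 i j)
    rw [hsum x _ X Y h1 h2 h3, sub_nonneg] at h4
    refine le_trans (Finset.sum_le_sum fun m _ => le_of_eq ?_) h4
    have : 0 < c + x * t m := by have := mul_nonneg hx0 (ht m); linarith
    field_simp
    ring)
  obtain ⟨X, Y, hq, hX0, h1, h2, h3⟩ := hdata fun m => t m / c
  have hall : ∀ i j, Q j * ((p i : ℂ) • 1 - (s j : ℂ) • ∑ m, ((t m / c : ℝ) : ℂ) • R m) * P i
      = 0 := by
    have h4 : ∀ i j, 0 ≤ p i ^ 2 * w i j / (s j + 0 * p i) - 2 * (p i * X i j)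
        + (s j * Y i j + 0 * (p i * Y i j)) := fun i j =>
      hterm 0 (p i) (s j) (w i j) (X i j) (Y i j)
        _ (re_trace_conjTranspose_mul_self_nonneg _) (hq i j _) (hs j) (hp i) le_rfl (hws0 i j)
        (hX0 i j)
    have h5 := hsum 0 _ X Y h1 h2 h3
    have h6 : ∑ m, (2 * (t m / c * t m) - (t m / c * (t m / c) * c
        + 0 * (t m / c * (t m / c) * t m))) = ∑ k, t k ^ 2 / c :=
      Finset.sum_congr rfl fun m _ => by field_simp; ring
    rw [h6, ← key] at h5
    simp only [zero_mul, add_zero, sub_self] at h4 h5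
    intro i j
    rw [Finset.sum_eq_zero_iff_of_nonneg (fun i _ => Finset.sum_nonneg fun j _ => h4 i j)] at h5
    have h7 := h5 i (Finset.mem_univ i)
    rw [Finset.sum_eq_zero_iff_of_nonneg (fun j _ => h4 i j)] at h7
    have h8 := h7 j (Finset.mem_univ j)
    apply mul_eq_zero_of_re_trace_eq_zero
    rw [hq]
    rcases eq_or_ne (s j) 0 with h | h
    · rw [h]
      linear_combination p i * hws0 i j h
    · field_simp at h8
      linear_combination h8
  have hfin : ρ - σ * ∑ m, ((t m / c : ℝ) : ℂ) • R m = 0 := by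
    have h4 : ∀ i j, (p i : ℂ) • (Q j * P i)
        - ((s j : ℂ) • Q j) * (∑ m, ((t m / c : ℝ) : ℂ) • R m) * P i = 0 := fun i j => by
      have := hall i j
      simpa [mul_sub, sub_mul, Matrix.mul_assoc] using this
    have h5 : ∑ i, ∑ j, ((p i : ℂ) • (Q j * P i)
        - ((s j : ℂ) • Q j) * (∑ m, ((t m / c : ℝ) : ℂ) • R m) * P i) = 0 :=
      Finset.sum_eq_zero fun i _ => Finset.sum_eq_zero fun j _ => h4 i j
    simpa only [Finset.sum_sub_distrib, ← Finset.smul_sum, ← Finset.sum_mul, ← Finset.mul_sum,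
      hQ.sum, hP.sum, Matrix.one_mul, Matrix.mul_one] using h5
  rw [sub_eq_zero.1 hfin, ← Matrix.mul_smul, Finset.smul_sum]
  congr 1
  refine Finset.sum_congr rfl fun m _ => ?_
  rw [smul_smul]
  congr 1
  push_cast
  field_simp
end

section
variable {b c a : Type*} [Fintype b] [Fintype c] [Fintype a]

theorem vNEntropy_eq {n : Type*} [Fintype n] [DecidableEq n] {M : Matrix n n ℂ}
    (hM : M.IsHermitian) :
    vNEntropy M = -∑ i, hM.eigenvalues i * Real.log (hM.eigenvalues i) := by
  have hinst : (inferInstance : DecidableEq n) = Classical.decEq n := Subsingleton.elim _ _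
  subst hinst
  rw [vNEntropy, dif_pos hM]

theorem vNEntropy_eq_roots {n : Type*} [Fintype n] [DecidableEq n] {M : Matrix n n ℂ}
    (hM : M.IsHermitian) :
    vNEntropy M = -((M.charpoly.roots.map fun z => z.re * Real.log z.re).sum) := by
  rw [vNEntropy_eq hM, hM.roots_charpoly_eq_eigenvalues]
  simp

theorem vNEntropy_submatrix {m n : Type*} [Fintype m] [Fintype n] {M : Matrix n n ℂ}
    (hM : M.IsHermitian) (e : m ≃ n) : vNEntropy (M.submatrix e e) = vNEntropy M := by
  classical
  rw [vNEntropy_eq_roots hM, vNEntropy_eq_roots (hM.submatrix e),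
    ← Matrix.charpoly_reindex e.symm M]
  rfl

theorem vNEntropy_smul_one {n : Type*} [Fintype n] [DecidableEq n] (r : ℝ) :
    vNEntropy ((r : ℂ) • (1 : Matrix n n ℂ)) = -(Fintype.card n * (r * Real.log r)) := by
  have hM : ((r : ℂ) • (1 : Matrix n n ℂ)).IsHermitian := by simp [IsHermitian]
  have h : ∀ i, hM.eigenvalues i = r := fun i => by
    have : Nonempty n := ⟨i⟩
    have h2 : (r : ℂ) • (1 : Matrix n n ℂ) = algebraMap ℝ _ r := by
      rw [Algebra.algebraMap_eq_smul_one]; ext; simp [Matrix.smul_apply]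
    have h3 : spectrum ℝ ((r : ℂ) • (1 : Matrix n n ℂ)) = {r} := by rw [h2, spectrum.scalar_eq]
    exact Set.mem_singleton_iff.1 (h3 ▸ hM.eigenvalues_mem_spectrum_real i)
  rw [vNEntropy_eq hM]
  simp only [h, Finset.sum_const, Finset.card_univ, nsmul_eq_mul]

theorem exists_spectral_resolution {n : Type*} [Fintype n] [DecidableEq n] {M : Matrix n n ℂ}
    (hM : M.PosSemidef) : ∃ (p : n → ℝ) (P : n → Matrix n n ℂ), IsProjResolution P ∧
      M = ∑ i, (p i : ℂ) • P i ∧ (∀ i, 0 ≤ p i) ∧ (∀ i, trace (P i) = 1) ∧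
      vNEntropy M = -∑ i, p i * Real.log (p i) := by
  have hH := hM.isHermitian
  set U : Matrix n n ℂ := (hH.eigenvectorUnitary : Matrix n n ℂ) with hU
  have hU1 : Uᴴ * U = 1 := Unitary.coe_star_mul_self hH.eigenvectorUnitary
  have hU2 : U * Uᴴ = 1 := Unitary.coe_mul_star_self hH.eigenvectorUnitary
  refine ⟨hH.eigenvalues, fun i => U * single i i 1 * Uᴴ, ⟨fun i => ?_, fun i j => ?_, ?_⟩, ?_,
    hM.eigenvalues_nonneg, fun i => ?_, vNEntropy_eq hH⟩
  · simp [IsHermitian, conjTranspose_mul, Matrix.mul_assoc]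
  · calc _ = U * (single i i 1 * (Uᴴ * U) * single j j 1) * Uᴴ := by noncomm_ring
      _ = _ := by
        rw [hU1, Matrix.mul_one]
        split_ifs with h
        · subst h; simp
        · simp [h]
  · rw [← Finset.sum_mul, ← Finset.mul_sum, Matrix.sum_single_one, Matrix.mul_one, hU2]
  · have h1 : M = U * diagonal (fun i => (hH.eigenvalues i : ℂ)) * Uᴴ := hH.spectral_theorem
    have h2 : ∑ i, (hH.eigenvalues i : ℂ) • (U * single i i 1 * Uᴴ)
        = U * (∑ i, single i i (hH.eigenvalues i : ℂ)) * Uᴴ := by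
      simp only [Finset.mul_sum, Finset.sum_mul]
      refine Finset.sum_congr rfl fun i _ => ?_
      rw [← Matrix.smul_mul, ← Matrix.mul_smul, smul_single, smul_eq_mul, mul_one]
    rw [h2, Matrix.sum_single_eq_diagonal]
    exact h1
  · rw [trace_mul_comm, ← Matrix.mul_assoc, hU1, Matrix.one_mul, trace_single_eq_same]

theorem extB_mul [DecidableEq c] (A B : Matrix (b × a) (b × a) ℂ) :
    (extB (A * B) : Matrix ((b × c) × a) _ ℂ) = extB A * extB B := by
  ext ⟨⟨x, g⟩, α⟩ ⟨⟨x', g'⟩, α'⟩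
  simp [extB, Matrix.mul_apply, Fintype.sum_prod_type]

theorem extC_mul [DecidableEq b] (A B : Matrix (c × a) (c × a) ℂ) :
    (extC (A * B) : Matrix ((b × c) × a) _ ℂ) = extC A * extC B := by
  ext ⟨⟨x, g⟩, α⟩ ⟨⟨x', g'⟩, α'⟩
  simp [extC, Matrix.mul_apply, Fintype.sum_prod_type]

theorem trace_mul_extB [DecidableEq c] (ρ : Matrix ((b × c) × a) ((b × c) × a) ℂ)
    (X : Matrix (b × a) (b × a) ℂ) : trace (ρ * extB X) = trace (margB ρ * X) := by
  simp only [trace, extB, margB, Matrix.mul_apply, Fintype.sum_prod_type, diag_apply, of_apply,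
    mul_ite, mul_one, mul_zero, Finset.sum_ite_irrel, Finset.sum_const_zero, Finset.sum_ite_eq',
    Finset.mem_univ, if_true, Finset.sum_mul]
  refine Finset.sum_congr rfl fun x _ => ?_
  rw [Finset.sum_comm]
  refine Finset.sum_congr rfl fun α _ => ?_
  rw [Finset.sum_comm]
  refine Finset.sum_congr rfl fun x' _ => ?_
  rw [Finset.sum_comm]

theorem trace_mul_extC [DecidableEq b] (ρ : Matrix ((b × c) × a) ((b × c) × a) ℂ)
    (X : Matrix (c × a) (c × a) ℂ) : trace (ρ * extC X) = trace (margC ρ * X) := by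
  simp only [trace, extC, margC, Matrix.mul_apply, Fintype.sum_prod_type, diag_apply, of_apply,
    mul_ite, mul_one, mul_zero, Finset.sum_ite_irrel, Finset.sum_const_zero, Finset.sum_ite_eq',
    Finset.mem_univ, if_true, Finset.sum_mul]
  rw [Finset.sum_comm]
  refine Finset.sum_congr rfl fun x _ => ?_
  rw [Finset.sum_comm]
  refine Finset.sum_congr rfl fun α _ => ?_
  rw [Finset.sum_comm]
  refine Finset.sum_congr rfl fun x' _ => ?_
  rw [Finset.sum_comm]

theorem trace_extB_mul_extC [DecidableEq b] [DecidableEq c] (X : Matrix (b × a) (b × a) ℂ)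
    (Y : Matrix (c × a) (c × a) ℂ) :
    trace (extB X * extC Y) = trace (ptrace₁ X * ptrace₁ Y) := by
  have h : ∀ α β : a, (∑ x, X (x, α) (x, β)) * ∑ g, Y (g, β) (g, α)
      = ∑ x, ∑ g, X (x, α) (x, β) * Y (g, β) (g, α) := fun α β => Finset.sum_mul_sum ..
  simp [trace, extC, extB, ptrace₁, Matrix.mul_apply, Fintype.sum_prod_type, h]
  rw [Finset.sum_comm_cycle]
  refine Finset.sum_congr rfl fun α _ => ?_
  rw [Finset.sum_comm_cycle]

theorem IsProjResolution.extB {ι : Type*} [Fintype ι] [DecidableEq ι] [DecidableEq b]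
    [DecidableEq c] [DecidableEq a]
    {P : ι → Matrix (b × a) (b × a) ℂ} (h : IsProjResolution P) :
    IsProjResolution fun i => (_root_.extB (P i) : Matrix ((b × c) × a) ((b × c) × a) ℂ) where
  herm i := by
    ext p q
    have := (h.herm i).apply (p.1.1, p.2) (q.1.1, q.2)
    by_cases hpq : p.1.2 = q.1.2
    · simpa [_root_.extB, hpq] using this
    · simp [_root_.extB, hpq, Ne.symm hpq]
  mul i j := by
    rw [← extB_mul, h.mul]
    split_ifs
    · rfl
    · ext; simp [_root_.extB]
  sum := by
    ext p q
    have := congrFun (congrFun h.sum (p.1.1, p.2)) (q.1.1, q.2)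
    rw [Matrix.sum_apply] at this ⊢
    simp only [_root_.extB, of_apply, ← Finset.sum_mul, this, Matrix.one_apply, Prod.ext_iff]
    split_ifs <;> simp_all

theorem IsProjResolution.extC {ι : Type*} [Fintype ι] [DecidableEq ι] [DecidableEq b]
    [DecidableEq c] [DecidableEq a]
    {P : ι → Matrix (c × a) (c × a) ℂ} (h : IsProjResolution P) :
    IsProjResolution fun i => (_root_.extC (P i) : Matrix ((b × c) × a) ((b × c) × a) ℂ) where
  herm i := by
    ext p q
    have := (h.herm i).apply (p.1.2, p.2) (q.1.2, q.2)
    by_cases hpq : p.1.1 = q.1.1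
    · simpa [_root_.extC, hpq] using this
    · simp [_root_.extC, hpq, Ne.symm hpq]
  mul i j := by
    rw [← extC_mul, h.mul]
    split_ifs
    · rfl
    · ext; simp [_root_.extC]
  sum := by
    ext p q
    have := congrFun (congrFun h.sum (p.1.2, p.2)) (q.1.2, q.2)
    rw [Matrix.sum_apply] at this ⊢
    simp only [_root_.extC, of_apply, ← Finset.sum_mul, this, Matrix.one_apply, Prod.ext_iff]
    split_ifs <;> simp_all

theorem extB_sum_smul {ι : Type*} [Fintype ι] [DecidableEq c] (x : ι → ℂ)
    (P : ι → Matrix (b × a) (b × a) ℂ) :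
    (extB (∑ i, x i • P i) : Matrix ((b × c) × a) _ ℂ) = ∑ i, x i • extB (P i) := by
  ext p q
  simp [extB, Matrix.sum_apply]

theorem extC_sum_smul {ι : Type*} [Fintype ι] [DecidableEq b] (x : ι → ℂ)
    (P : ι → Matrix (c × a) (c × a) ℂ) :
    (extC (∑ i, x i • P i) : Matrix ((b × c) × a) _ ℂ) = ∑ i, x i • extC (P i) := by
  ext p q
  simp [extC, Matrix.sum_apply]

theorem margB_posSemidef {ρ : Matrix ((b × c) × a) ((b × c) × a) ℂ} (h : ρ.PosSemidef) :
    (margB ρ).PosSemidef := by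
  have : margB ρ = ∑ g, ρ.submatrix (fun p : b × a => ((p.1, g), p.2))
      (fun p => ((p.1, g), p.2)) := by
    ext; simp [margB, Matrix.sum_apply]
  rw [this]
  exact Matrix.posSemidef_sum _ fun g _ => h.submatrix _

theorem margC_posSemidef {ρ : Matrix ((b × c) × a) ((b × c) × a) ℂ} (h : ρ.PosSemidef) :
    (margC ρ).PosSemidef := by
  have : margC ρ = ∑ x, ρ.submatrix (fun p : c × a => ((x, p.1), p.2))
      (fun p => ((x, p.1), p.2)) := by
    ext; simp [margC, Matrix.sum_apply]
  rw [this]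
  exact Matrix.posSemidef_sum _ fun g _ => h.submatrix _

theorem ptrace₁_margB (ρ : Matrix ((b × c) × a) ((b × c) × a) ℂ) :
    ptrace₁ (margB ρ) = ptrace₁ ρ := by
  ext; simp [ptrace₁, margB, Fintype.sum_prod_type]

theorem ptrace₁_margC (ρ : Matrix ((b × c) × a) ((b × c) × a) ℂ) :
    ptrace₁ (margC ρ) = ptrace₁ ρ := by
  ext; simp [ptrace₁, margC, Fintype.sum_prod_type_right]

theorem trace_ptrace₁ (M : Matrix (b × a) (b × a) ℂ) : trace (ptrace₁ M) = trace M := by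
  simp [ptrace₁, trace, Fintype.sum_prod_type_right]

theorem smul_eq_extB_mul_extC [DecidableEq b] [DecidableEq c] [DecidableEq a]
    {ρ : Matrix ((b × c) × a) ((b × c) × a) ℂ} (hρ : ρ.PosSemidef) {r : ℝ} (hr : 0 < r)
    (hρ1 : ptrace₁ ρ = (r : ℂ) • 1) (hcmi : qcmiBCA ρ = 0) :
    (r : ℂ) • ρ = extB (margB ρ) * extC (margC ρ) := by
  obtain ⟨p, P, hP, hρP, hp, hP1, hpe⟩ := exists_spectral_resolution hρ
  obtain ⟨s, Q, hQ, hσQ, hs, hQ1, hse⟩ := exists_spectral_resolution (margB_posSemidef hρ)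
  obtain ⟨t, R, hR, hτR, ht, hR1, hte⟩ := exists_spectral_resolution (margC_posSemidef hρ)
  have e1 : (extB (margB ρ) : Matrix ((b × c) × a) _ ℂ) = ∑ j, (s j : ℂ) • extB (Q j) := by
    rw [← extB_sum_smul, ← hσQ]
  have e2 : (extC (margC ρ) : Matrix ((b × c) × a) _ ℂ) = ∑ j, (t j : ℂ) • extC (R j) := by
    rw [← extC_sum_smul, ← hτR]
  have htsum : ∑ k, t k = Fintype.card a * r := by
    have h1 : trace (margC ρ) = Fintype.card a * r := by
      rw [← trace_ptrace₁, ptrace₁_margC, hρ1, trace_smul, trace_one, smul_eq_mul, mul_comm]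
    rw [hτR, trace_sum] at h1
    simp only [trace_smul, hR1, smul_eq_mul, mul_one] at h1
    exact_mod_cast h1
  have key := smul_eq_mul_of_entropy_eq hP hQ.extB hR.extC hr hp hs ht hP1 (fun j => ?_)
    (fun k => ?_) (fun k => ?_) ?_
  · rw [e1, e2, ← key, ← hρP]
  · rw [← hρP, trace_mul_extB, hσQ]
    simp [Finset.sum_mul, hQ.mul, apply_ite, hQ1]
  · rw [← hρP, trace_mul_extC, hτR]
    simp [Finset.sum_mul, hR.mul, apply_ite, hR1]
  · rw [← e1, trace_extB_mul_extC, ptrace₁_margB, hρ1, Matrix.smul_mul, Matrix.one_mul, trace_smul,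
      trace_ptrace₁, hR1, smul_eq_mul, mul_one]
  · have h1 := hcmi
    rw [qcmiBCA, hpe, hse, hte, hρ1, vNEntropy_smul_one] at h1
    rw [htsum]
    linarith

end

section
variable {S n : Type*} [Fintype n] [DecidableEq n]

/-- A family of matrices closed under conjugate transposition. -/
def IsStarClosed (X : S → Matrix n n ℂ) : Prop := ∀ s, ∃ s', X s' = (X s)ᴴ

/-- A family of matrices on a nonzero space whose commutant consists of scalars. -/
def IsIrreducibleFamily (X : S → Matrix n n ℂ) : Prop :=
  Nonempty n ∧ ∀ Z, (∀ s, Commute Z (X s)) → ∃ c : ℂ, Z = c • 1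

/-- Isometries `C i` whose ranges form an orthogonal decomposition of the whole space. -/
structure IsOrthogonalDecomposition {ι : Type*} [Fintype ι] {d : ι → Type*} [∀ i, Fintype (d i)]
    [∀ i, DecidableEq (d i)] (C : ∀ i, Matrix n (d i) ℂ) : Prop where
  iso : ∀ i, (C i)ᴴ * C i = 1
  orth : ∀ i j, i ≠ j → (C i)ᴴ * C j = 0
  sum : ∑ i, C i * (C i)ᴴ = 1

theorem IsOrthogonalDecomposition.sum_mul_conjTranspose {ι m : Type*} [Fintype ι] {d : ι → Type*}
    [∀ i, Fintype (d i)] [∀ i, DecidableEq (d i)] {C : ∀ i, Matrix n (d i) ℂ}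
    (hC : IsOrthogonalDecomposition C) (G : Matrix m n ℂ) :
    ∑ i, G * C i * (G * C i)ᴴ = G * Gᴴ := by
  have h : ∀ i, G * C i * (G * C i)ᴴ = G * (C i * (C i)ᴴ) * Gᴴ := fun i => by
    simp only [conjTranspose_mul, Matrix.mul_assoc]
  simp only [h]
  rw [← Matrix.sum_mul, ← Matrix.mul_sum, hC.sum, Matrix.mul_one]

theorem exists_isHermitian_not_scalar {X : S → Matrix n n ℂ} (hX : IsStarClosed X)
    {Z : Matrix n n ℂ} (hZ : ∀ s, Commute Z (X s)) (hZ1 : ∀ c : ℂ, Z ≠ c • 1) :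
    ∃ H : Matrix n n ℂ, H.IsHermitian ∧ (∀ s, Commute H (X s)) ∧ ∀ c : ℂ, H ≠ c • 1 := by
  have hZ2 : ∀ s, Commute Zᴴ (X s) := fun s => by
    obtain ⟨s', hs'⟩ := hX s
    have h1 := congrArg conjTranspose (hZ s').eq
    rw [hs', conjTranspose_mul, conjTranspose_mul, conjTranspose_conjTranspose] at h1
    exact h1.symm
  by_contra! h
  obtain ⟨c, hc⟩ := h (Z + Zᴴ) (by simp [IsHermitian, add_comm])
    (fun s => (hZ s).add_left (hZ2 s))
  obtain ⟨e, he⟩ := h (Complex.I • (Z - Zᴴ))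
    (by simp [IsHermitian, conjTranspose_smul, ← smul_neg])
    (fun s => ((hZ s).sub_left (hZ2 s)).smul_left _)
  refine hZ1 ((c - Complex.I * e) / 2) ?_
  have h1 : Z - Zᴴ = (-Complex.I * e) • 1 := by
    rw [mul_smul, ← he, smul_smul]; simp
  have h2 : (2 : ℂ) • Z = (Z + Zᴴ) + (Z - Zᴴ) := by rw [two_smul]; abel
  rw [hc, h1, ← add_smul] at h2
  rw [div_eq_inv_mul, mul_smul, sub_eq_add_neg, ← neg_mul, ← h2, smul_smul]
  simp

theorem exists_eigenspace_splitting {X : S → Matrix n n ℂ} {H : Matrix n n ℂ}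
    (hH : H.IsHermitian) (hX : ∀ s, Commute H (X s)) (hH1 : ∀ c : ℂ, H ≠ c • 1) :
    ∃ (p : n → Prop) (_ : DecidablePred p) (E : Matrix n {x // p x} ℂ)
      (F : Matrix n {x // ¬ p x} ℂ),
      (∃ x, p x) ∧ (∃ x, ¬ p x) ∧ Eᴴ * E = 1 ∧ Fᴴ * F = 1 ∧ Eᴴ * F = 0 ∧
      E * Eᴴ + F * Fᴴ = 1 ∧ (∀ s, X s * E = E * (Eᴴ * X s * E)) ∧
      (∀ s, X s * F = F * (Fᴴ * X s * F)) := by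
  set U : Matrix n n ℂ := (hH.eigenvectorUnitary : Matrix n n ℂ) with hU
  have hU1 : Uᴴ * U = 1 := Unitary.coe_star_mul_self hH.eigenvectorUnitary
  have hU2 : U * Uᴴ = 1 := Unitary.coe_mul_star_self hH.eigenvectorUnitary
  set D : Matrix n n ℂ := diagonal (fun i => (hH.eigenvalues i : ℂ)) with hD
  have hHD : H = U * D * Uᴴ := hH.spectral_theorem
  have hne : Nonempty n := by
    by_contra h
    rw [not_nonempty_iff] at h
    exact hH1 0 (Subsingleton.elim _ _)
  obtain ⟨x0⟩ := hne
  have hx1 : ∃ x, ¬ hH.eigenvalues x = hH.eigenvalues x0 := by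
    by_contra! h
    refine hH1 (hH.eigenvalues x0) ?_
    have : D = (hH.eigenvalues x0 : ℂ) • 1 := by
      rw [hD, smul_one_eq_diagonal]; simp only [h]
    refine hHD.trans ?_
    rw [this, Matrix.mul_smul, Matrix.mul_one, Matrix.smul_mul, hU2]
  have hcomm : ∀ s, D * (Uᴴ * X s * U) = (Uᴴ * X s * U) * D := fun s => by
    have h1 : D = Uᴴ * H * U := by
      rw [hHD]
      calc D = (Uᴴ * U) * D * (Uᴴ * U) := by rw [hU1, Matrix.one_mul, Matrix.mul_one]
        _ = _ := by noncomm_ring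
    calc _ = Uᴴ * (H * (U * Uᴴ) * X s) * U := by rw [h1]; noncomm_ring
      _ = Uᴴ * (X s * (U * Uᴴ) * H) * U := by
        rw [hU2, Matrix.mul_one, Matrix.mul_one, (hX s).eq]
      _ = _ := by rw [h1]; noncomm_ring
  have hz : ∀ s x y, hH.eigenvalues x ≠ hH.eigenvalues y → (Uᴴ * X s * U) x y = 0 := by
    intro s x y hxy
    have h1 := congrFun (congrFun (hcomm s) x) y
    rw [hD, diagonal_mul, mul_diagonal, mul_comm, ← sub_eq_zero, ← mul_sub] at h1
    refine (mul_eq_zero.1 h1).resolve_right (sub_ne_zero.2 ?_)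
    exact_mod_cast hxy
  set p : n → Prop := fun x => hH.eigenvalues x = hH.eigenvalues x0 with hp
  have hsub : ∀ {q r : n → Prop}, (U.submatrix id (Subtype.val : {x // q x} → n))ᴴ *
      U.submatrix id (Subtype.val : {x // r x} → n)
      = (1 : Matrix n n ℂ).submatrix Subtype.val Subtype.val := fun {q r} => by
    rw [← hU1]; rfl
  have hsub2 : ∀ s {q r : n → Prop}, (U.submatrix id (Subtype.val : {x // q x} → n))ᴴ *
      X s * U.submatrix id (Subtype.val : {x // r x} → n)
      = (Uᴴ * X s * U).submatrix Subtype.val Subtype.val := fun s {q r} => rfl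
  have hUX : ∀ s, X s * U = U * (Uᴴ * X s * U) := fun s => by
    rw [← Matrix.mul_assoc, ← Matrix.mul_assoc, hU2, Matrix.one_mul]
  have hinv : ∀ s (q : n → Prop) [DecidablePred q], (∀ x y, ¬ q x → q y → (Uᴴ * X s * U) x y = 0) →
      X s * U.submatrix id (Subtype.val : {x // q x} → n)
      = U.submatrix id (Subtype.val : {x // q x} → n) *
        ((U.submatrix id (Subtype.val : {x // q x} → n))ᴴ * X s *
          U.submatrix id (Subtype.val : {x // q x} → n)) := fun s q _ hq => by
    rw [hsub2]
    ext x y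
    have h1 := congrFun (congrFun (hUX s) x) y.1
    have h2 : (X s * U) x y.1 = (X s * U.submatrix id (Subtype.val : {x // q x} → n)) x y := rfl
    rw [← h2, h1, Matrix.mul_apply, Matrix.mul_apply,
      ← Fintype.sum_subtype_add_sum_subtype q]
    refine (add_eq_left.2 ?_).trans rfl
    exact Finset.sum_eq_zero fun z _ => by rw [hq z.1 y.1 z.2 y.2, mul_zero]
  classical
  refine ⟨p, inferInstance, U.submatrix id Subtype.val, U.submatrix id Subtype.val, ⟨x0, rfl⟩, hx1,
    ?_, ?_, ?_, ?_,
    fun s => hinv s _ fun x y hx hy => hz s x y fun h => hx (h.trans hy),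
    fun s => hinv s _ fun x y hx hy => hz s x y fun h => hy (h.symm.trans (not_not.1 hx))⟩
  · rw [hsub, submatrix_one _ Subtype.val_injective]
  · rw [hsub, submatrix_one _ Subtype.val_injective]
  · rw [hsub]
    ext x y
    rw [submatrix_apply, Matrix.zero_apply]
    exact Matrix.one_apply_ne fun h => y.2 (h ▸ x.2)
  · rw [← hU2]
    ext x y
    rw [Matrix.add_apply, Matrix.mul_apply, Matrix.mul_apply, Matrix.mul_apply,
      ← Fintype.sum_subtype_add_sum_subtype p]
    rfl

theorem exists_irreducible_decomposition {S : Type*} {n : Type*} [Fintype n] [DecidableEq n]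
    (X : S → Matrix n n ℂ) (hX : IsStarClosed X) :
    ∃ (ι : Type) (_ : Fintype ι) (_ : DecidableEq ι) (d : ι → ℕ)
      (C : ∀ i, Matrix n (Fin (d i)) ℂ) (Y : ∀ i, S → Matrix (Fin (d i)) (Fin (d i)) ℂ),
      IsOrthogonalDecomposition C ∧ (∀ i s, X s * C i = C i * Y i s) ∧
      ∀ i, IsIrreducibleFamily (Y i) := by
  induction hN : Fintype.card n using Nat.strong_induction_on generalizing n with
  | _ N ih =>
  subst hN
  rcases isEmpty_or_nonempty n with hn | hn
  · exact ⟨Empty, inferInstance, inferInstance, nofun, nofun, nofun,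
      ⟨nofun, nofun, Subsingleton.elim _ _⟩, nofun, nofun⟩
  by_cases hirr : IsIrreducibleFamily X
  · let e := Fintype.equivFin n
    have h1 : ((1 : Matrix n n ℂ).submatrix id e.symm)ᴴ
        = (1 : Matrix n n ℂ).submatrix e.symm id := by
      rw [conjTranspose_submatrix, conjTranspose_one]
    have hiso : (1 : Matrix n n ℂ).submatrix e.symm id * (1 : Matrix n n ℂ).submatrix id e.symm
        = 1 := by
      rw [← submatrix_mul _ _ _ _ _ Function.bijective_id, Matrix.mul_one, submatrix_one_equiv]
    have hiso2 : (1 : Matrix n n ℂ).submatrix id e.symm * (1 : Matrix n n ℂ).submatrix e.symm id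
        = 1 := by
      rw [submatrix_mul_equiv, Matrix.mul_one, submatrix_id_id]
    have hY : ∀ M : Matrix n n ℂ, M * (1 : Matrix n n ℂ).submatrix id e.symm
        = (1 : Matrix n n ℂ).submatrix id e.symm * M.submatrix e.symm e.symm := fun M => by
      rw [submatrix_mul_equiv, Matrix.one_mul]
      ext; simp [Matrix.mul_apply, Matrix.one_apply]
    refine ⟨Unit, inferInstance, inferInstance, fun _ => Fintype.card n,
      fun _ => (1 : Matrix n n ℂ).submatrix id e.symm, fun _ s => (X s).submatrix e.symm e.symm,
      ⟨fun _ => by rw [h1, hiso], fun i j h => absurd rfl h, ?_⟩, fun _ s => hY _,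
      fun _ => ⟨hn.map e, fun Z hZ => ?_⟩⟩
    · rw [Finset.univ_unique, Finset.sum_singleton, h1, hiso2]
    · obtain ⟨c, hc⟩ := hirr.2 (Z.submatrix e e) fun s => by
        have h2 := congrArg (fun M => M.submatrix e e) (hZ s).eq
        simp only [← submatrix_mul_equiv _ _ e e e, submatrix_submatrix] at h2
        simp only [Equiv.symm_comp_self, submatrix_id_id] at h2
        exact h2
      refine ⟨c, ?_⟩
      have h2 := congrArg (fun M => M.submatrix e.symm e.symm) hc
      simpa [submatrix_submatrix, submatrix_smul] using h2
  · obtain ⟨Z, hZ, hZ1⟩ : ∃ Z, (∀ s, Commute Z (X s)) ∧ ∀ c : ℂ, Z ≠ c • 1 := by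
      by_contra! h
      exact hirr ⟨hn, h⟩
    obtain ⟨H, hH, hHX, hH1⟩ := exists_isHermitian_not_scalar hX hZ hZ1
    obtain ⟨p, _, E, F, ⟨x, hx⟩, ⟨y, hy⟩, hE, hF, hEF, hsum, hXE, hXF⟩ :=
      exists_eigenspace_splitting hH hHX hH1
    classical
    have hstar : ∀ {m : Type _} (G : Matrix n m ℂ), IsStarClosed fun s => Gᴴ * X s * G :=
      fun G s => by
        obtain ⟨s', hs'⟩ := hX s
        exact ⟨s', by simp [hs', conjTranspose_mul, Matrix.mul_assoc]⟩
    obtain ⟨ι₁, _, _, d₁, C₁, Y₁, hC₁, hXC₁, hY₁⟩ := ih _ (Fintype.card_subtype_lt hy) _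
      (hstar E) rfl
    obtain ⟨ι₂, _, _, d₂, C₂, Y₂, hC₂, hXC₂, hY₂⟩ := ih _ (Fintype.card_subtype_lt (not_not.2 hx)) _
      (hstar F) rfl
    have hFE : Fᴴ * E = 0 := by
      rw [← conjTranspose_conjTranspose E, ← conjTranspose_mul, hEF, conjTranspose_zero]
    have hc : ∀ {m₁ m₂ m₃ m₄ : Type _} [Fintype m₁] [Fintype m₂] [Fintype m₃] [Fintype m₄]
        (A : Matrix n m₁ ℂ) (B : Matrix m₁ m₂ ℂ) (A' : Matrix n m₃ ℂ) (B' : Matrix m₃ m₄ ℂ),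
        (A * B)ᴴ * (A' * B') = Bᴴ * (Aᴴ * A') * B' := fun A B A' B' => by
      simp only [conjTranspose_mul, Matrix.mul_assoc]
    refine ⟨ι₁ ⊕ ι₂, inferInstance, inferInstance, Sum.elim d₁ d₂,
      Sum.rec (fun i => E * C₁ i) (fun i => F * C₂ i), Sum.rec Y₁ Y₂, ⟨?_, ?_, ?_⟩, ?_, ?_⟩
    · rintro (i | i)
      · refine (hc _ _ _ _).trans ?_
        rw [hE, Matrix.mul_one]; exact hC₁.iso i
      · refine (hc _ _ _ _).trans ?_
        rw [hF, Matrix.mul_one]; exact hC₂.iso i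
    · rintro (i | i) (j | j) hij
      · refine (hc _ _ _ _).trans ?_
        rw [hE, Matrix.mul_one]; exact hC₁.orth i j fun h => hij (h ▸ rfl)
      · refine (hc _ _ _ _).trans ?_
        rw [hEF, Matrix.mul_zero, Matrix.zero_mul]; rfl
      · refine (hc _ _ _ _).trans ?_
        rw [hFE, Matrix.mul_zero, Matrix.zero_mul]; rfl
      · refine (hc _ _ _ _).trans ?_
        rw [hF, Matrix.mul_one]; exact hC₂.orth i j fun h => hij (h ▸ rfl)
    · rw [Fintype.sum_sum_type, ← hsum]
      congr 1
      · exact hC₁.sum_mul_conjTranspose E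
      · exact hC₂.sum_mul_conjTranspose F
    · rintro (i | i) s
      · show X s * (E * C₁ i) = E * C₁ i * Y₁ i s
        rw [← Matrix.mul_assoc, hXE, Matrix.mul_assoc, hXC₁, Matrix.mul_assoc]
      · show X s * (F * C₂ i) = F * C₂ i * Y₂ i s
        rw [← Matrix.mul_assoc, hXF, Matrix.mul_assoc, hXC₂, Matrix.mul_assoc]
    · rintro (i | i)
      · exact hY₁ i
      · exact hY₂ i

theorem IsIrreducibleFamily.intertwiner_eq_zero_or {m₁ m₂ : Type*} [Fintype m₁] [DecidableEq m₁]
    [Fintype m₂] [DecidableEq m₂] {Y₁ : S → Matrix m₁ m₁ ℂ} {Y₂ : S → Matrix m₂ m₂ ℂ}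
    (h₁ : IsIrreducibleFamily Y₁) (h₂ : IsIrreducibleFamily Y₂) {T : Matrix m₂ m₁ ℂ}
    (hT : ∀ s, T * Y₁ s = Y₂ s * T) (hT' : ∀ s, Tᴴ * Y₂ s = Y₁ s * Tᴴ) :
    T = 0 ∨ ∃ c : ℝ, 0 < c ∧ Tᴴ * T = (c : ℂ) • 1 ∧ T * Tᴴ = (c : ℂ) • 1 := by
  by_cases h0 : T = 0
  · exact Or.inl h0
  right
  obtain ⟨c, hc⟩ := h₁.2 (Tᴴ * T) fun s => by
    show Tᴴ * T * Y₁ s = Y₁ s * (Tᴴ * T)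
    rw [Matrix.mul_assoc, hT, ← Matrix.mul_assoc, hT', Matrix.mul_assoc]
  obtain ⟨c', hc'⟩ := h₂.2 (T * Tᴴ) fun s => by
    show T * Tᴴ * Y₂ s = Y₂ s * (T * Tᴴ)
    rw [Matrix.mul_assoc, hT', ← Matrix.mul_assoc, hT, Matrix.mul_assoc]
  have hcc : c = c' := by
    have h3 : c • T = c' • T := by
      calc c • T = T * (Tᴴ * T) := by rw [hc, Matrix.mul_smul, Matrix.mul_one]
        _ = c' • T := by rw [← Matrix.mul_assoc, hc', Matrix.smul_mul, Matrix.one_mul]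
    rw [← sub_eq_zero, ← sub_smul, smul_eq_zero, or_iff_left h0] at h3
    exact sub_eq_zero.1 h3
  subst hcc
  obtain ⟨x⟩ := h₁.1
  have hnn : 0 ≤ c := by
    have := (Matrix.posSemidef_conjTranspose_mul_self T).diag_nonneg (i := x)
    rw [hc] at this
    simpa using this
  have hne : c ≠ 0 := by
    rintro rfl
    rw [zero_smul] at hc
    exact h0 (Matrix.conjTranspose_mul_self_eq_zero.1 hc)
  have hre : ((c.re : ℝ) : ℂ) = c := Complex.ext rfl (Complex.nonneg_iff.1 hnn).2
  refine ⟨c.re, lt_of_le_of_ne (Complex.nonneg_iff.1 hnn).1 fun h => hne ?_, ?_, ?_⟩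
  · rw [← hre, ← h]; simp
  · rw [hre, hc]
  · rw [hre, hc']

theorem compress_eq {m : Type*} [Fintype m] [DecidableEq m] {X : Matrix n n ℂ}
    {C : Matrix n m ℂ} {Y : Matrix m m ℂ} (hC : Cᴴ * C = 1) (h : X * C = C * Y) :
    Y = Cᴴ * X * C := by
  rw [Matrix.mul_assoc, h, ← Matrix.mul_assoc, hC, Matrix.one_mul]

theorem IsStarClosed.compress {m : Type*} [Fintype m] [DecidableEq m] {X : S → Matrix n n ℂ}
    (hX : IsStarClosed X) {C : Matrix n m ℂ} {Y : S → Matrix m m ℂ} (hC : Cᴴ * C = 1)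
    (h : ∀ s, X s * C = C * Y s) : IsStarClosed Y := fun s => by
  obtain ⟨s', hs'⟩ := hX s
  refine ⟨s', ?_⟩
  rw [compress_eq hC (h s'), compress_eq hC (h s), hs']
  simp only [conjTranspose_mul, conjTranspose_conjTranspose, Matrix.mul_assoc]

theorem IsStarClosed.conjTranspose_intertwines {m : Type*} [Fintype m] [DecidableEq m]
    {X : S → Matrix n n ℂ}
    (hX : IsStarClosed X) {C : Matrix n m ℂ} {Y : S → Matrix m m ℂ} (hC : Cᴴ * C = 1)
    (h : ∀ s, X s * C = C * Y s) (s : S) : Cᴴ * X s = Y s * Cᴴ := by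
  obtain ⟨s', hs'⟩ := hX s
  have h1 : Y s' = (Y s)ᴴ := by
    rw [compress_eq hC (h s'), compress_eq hC (h s), hs']
    simp only [conjTranspose_mul, conjTranspose_conjTranspose, Matrix.mul_assoc]
  have h2 := congrArg conjTranspose (h s')
  rw [h1, hs'] at h2
  simpa [conjTranspose_mul] using h2

theorem IsOrthogonalDecomposition.eq_zero_of_forall {ι m : Type*} [Fintype ι] {d : ι → Type*}
    [∀ i, Fintype (d i)] [∀ i, DecidableEq (d i)] {C : ∀ i, Matrix n (d i) ℂ}
    (hC : IsOrthogonalDecomposition C) {A : Matrix n m ℂ} (h : ∀ i, (C i)ᴴ * A = 0) : A = 0 := by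
  rw [← Matrix.one_mul A, ← hC.sum, Matrix.sum_mul]
  exact Finset.sum_eq_zero fun i _ => by rw [Matrix.mul_assoc, h, Matrix.mul_zero]

/-- The blocks of a star-closed family which, together with a family commuting with it, is
irreducible, are all equivalent. -/
theorem exists_ne_zero_intertwiner {R : Type*} {X : S → Matrix n n ℂ} (hX : IsStarClosed X)
    {W : R → Matrix n n ℂ} (hW : IsStarClosed W) (hXW : ∀ s t, Commute (X s) (W t))
    (hirr : ∀ Z, (∀ s, Commute Z (X s)) → (∀ t, Commute Z (W t)) → ∃ c : ℂ, Z = c • 1)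
    {ι : Type*} [Fintype ι] {d : ι → Type*} [∀ i, Fintype (d i)]
    [∀ i, DecidableEq (d i)] {C : ∀ i, Matrix n (d i) ℂ} (hC : IsOrthogonalDecomposition C)
    {Y : ∀ i, S → Matrix (d i) (d i) ℂ} (hXC : ∀ i s, X s * C i = C i * Y i s)
    (hY : ∀ i, IsIrreducibleFamily (Y i)) (i₀ i : ι) :
    ∃ T : Matrix (d i) (d i₀) ℂ, T ≠ 0 ∧ (∀ s, T * Y i₀ s = Y i s * T) ∧
      ∀ s, Tᴴ * Y i s = Y i₀ s * Tᴴ := by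
  classical
  set P : ι → Prop := fun i => ∃ T : Matrix (d i) (d i₀) ℂ, T ≠ 0 ∧
    (∀ s, T * Y i₀ s = Y i s * T) ∧ ∀ s, Tᴴ * Y i s = Y i₀ s * Tᴴ with hP
  have hadj : ∀ i s, (C i)ᴴ * X s = Y i s * (C i)ᴴ := fun i s =>
    hX.conjTranspose_intertwines (hC.iso i) (hXC i) s
  have hint : ∀ t i j s, ((C i)ᴴ * W t * C j) * Y j s = Y i s * ((C i)ᴴ * W t * C j) := by
    intro t i j s
    rw [Matrix.mul_assoc, ← hXC, ← Matrix.mul_assoc, Matrix.mul_assoc (C i)ᴴ, ← (hXW s t).eq,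
      ← Matrix.mul_assoc, hadj]
    simp only [Matrix.mul_assoc]
  have hconj : ∀ t i j, ∃ t', ((C i)ᴴ * W t * C j)ᴴ = (C j)ᴴ * W t' * C i := fun t i j => by
    obtain ⟨t', ht'⟩ := hW t
    exact ⟨t', by simp only [conjTranspose_mul, conjTranspose_conjTranspose, ht',
      Matrix.mul_assoc]⟩
  have hclosed : ∀ t i j, P i → ¬ P j → (C j)ᴴ * W t * C i = 0 := by
    rintro t i j ⟨T, hT0, hT1, hT2⟩ hj
    by_contra hne
    obtain ⟨t', ht'⟩ := hconj t j i
    obtain rfl | ⟨c, hc, -, hTT⟩ := (hY i₀).intertwiner_eq_zero_or (hY i) hT1 hT2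
    · exact hT0 rfl
    refine hj ⟨(C j)ᴴ * W t * C i * T, fun h0 => hne ?_, fun s => ?_, fun s => ?_⟩
    · have h1 := congrArg (· * Tᴴ) h0
      simp only [Matrix.zero_mul] at h1
      rw [Matrix.mul_assoc, hTT, Matrix.mul_smul, Matrix.mul_one, smul_eq_zero] at h1
      exact h1.resolve_left (by exact_mod_cast hc.ne')
    · rw [Matrix.mul_assoc, hT1, ← Matrix.mul_assoc, hint, Matrix.mul_assoc]
    · rw [conjTranspose_mul, ht', Matrix.mul_assoc, hint, ← Matrix.mul_assoc, hT2, Matrix.mul_assoc]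
  have hclosed' : ∀ t i j, P i → ¬ P j → (C i)ᴴ * W t * C j = 0 := fun t i j hi hj => by
    obtain ⟨t', ht'⟩ := hconj t i j
    rw [← conjTranspose_eq_zero, ht', hclosed t' i j hi hj]
  set Q : Matrix n n ℂ := ∑ i with P i, C i * (C i)ᴴ with hQ
  have hCQ : ∀ i, (C i)ᴴ * Q = if P i then (C i)ᴴ else 0 := fun i => by
    rw [hQ, Matrix.mul_sum, Finset.sum_congr rfl fun j _ => (Matrix.mul_assoc _ _ _).symm]
    have : ∀ j, (C i)ᴴ * C j * (C j)ᴴ = if i = j then (C i)ᴴ else 0 := fun j => by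
      split_ifs with h
      · subst h; rw [hC.iso, Matrix.one_mul]
      · rw [hC.orth i j h, Matrix.zero_mul]
    simp [this]
  have hQC : ∀ i, Q * C i = if P i then C i else 0 := fun i => by
    have h1 : Qᴴ = Q := by simp [hQ, conjTranspose_sum, conjTranspose_mul]
    have h2 := congrArg conjTranspose (hCQ i)
    rw [conjTranspose_mul, h1, conjTranspose_conjTranspose] at h2
    rw [h2]; split_ifs <;> simp
  have hext : ∀ A B : Matrix n n ℂ, (∀ i j, (C i)ᴴ * A * C j = (C i)ᴴ * B * C j) → A = B := by
    intro A B h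
    rw [← sub_eq_zero]
    refine hC.eq_zero_of_forall fun i => ?_
    rw [← conjTranspose_eq_zero]
    refine hC.eq_zero_of_forall fun j => ?_
    rw [← conjTranspose_mul, conjTranspose_eq_zero, Matrix.mul_sub, Matrix.sub_mul, h i j, sub_self]
  have hcomm : ∀ A : Matrix n n ℂ, (∀ i j, P i → ¬ P j → (C i)ᴴ * A * C j = 0) →
      (∀ i j, P i → ¬ P j → (C j)ᴴ * A * C i = 0) → Commute Q A := by
    refine fun A h1 h2 => hext _ _ fun i j => ?_
    rw [← Matrix.mul_assoc, hCQ, ← Matrix.mul_assoc, Matrix.mul_assoc _ Q, hQC]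
    by_cases hi : P i <;> by_cases hj : P j
    · simp [hi, hj]
    · simp [hi, hj, h1]
    · simp [hi, hj, h2]
    · simp [hi, hj]
  obtain ⟨c, hc⟩ := hirr Q
    (fun s => hcomm _
      (fun i j hi hj => by
        rw [Matrix.mul_assoc, hXC, ← Matrix.mul_assoc, hC.orth i j (fun h => hj (h ▸ hi)),
          Matrix.zero_mul])
      (fun i j hi hj => by
        rw [Matrix.mul_assoc, hXC, ← Matrix.mul_assoc, hC.orth j i (fun h => hj (h ▸ hi)),
          Matrix.zero_mul]))
    (fun t => hcomm _ (hclosed' t) (hclosed t))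
  have hP0 : P i₀ := by
    obtain ⟨x⟩ := (hY i₀).1
    have : Nonempty (d i₀) := ⟨x⟩
    exact ⟨1, one_ne_zero, fun s => by simp, fun s => by simp⟩
  by_contra hPi
  have h0 := hQC i₀
  have h1 := hQC i
  rw [if_pos hP0, hc, Matrix.smul_mul, Matrix.one_mul] at h0
  rw [if_neg hPi, hc, Matrix.smul_mul, Matrix.one_mul, smul_eq_zero] at h1
  have hne : ∀ i, C i ≠ 0 := fun i hi => by
    obtain ⟨x⟩ := (hY i).1
    have : Nonempty (d i) := ⟨x⟩
    have h3 := hC.iso i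
    rw [hi, Matrix.mul_zero] at h3
    exact zero_ne_one h3
  rw [h1.resolve_right (hne i), zero_smul] at h0
  exact hne i₀ h0.symm

/-- The operator `A ⊗ 1`. -/
def tensorLeft {p : Type*} (q : Type*) [DecidableEq q] (A : Matrix p p ℂ) :
    Matrix (p × q) (p × q) ℂ :=
  kroneckerMap (· * ·) A 1

/-- The operator `1 ⊗ B`. -/
def tensorRight (p : Type*) {q : Type*} [DecidableEq p] (B : Matrix q q ℂ) :
    Matrix (p × q) (p × q) ℂ :=
  kroneckerMap (· * ·) 1 B

theorem commute_tensorRight_tensorLeft {p q : Type*} [Fintype p] [DecidableEq p] [Fintype q]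
    [DecidableEq q] (A : Matrix p p ℂ) (B : Matrix q q ℂ) :
    Commute (tensorRight p B) (tensorLeft q A) := by
  show kroneckerMap _ _ _ * kroneckerMap _ _ _ = kroneckerMap _ _ _ * kroneckerMap _ _ _
  rw [← mul_kronecker_mul, ← mul_kronecker_mul]
  simp only [Matrix.mul_one, Matrix.one_mul]

theorem Commute.tensorRight {p q : Type*} [Fintype p] [DecidableEq p] [Fintype q]
    {A B : Matrix q q ℂ} (h : Commute A B) :
    Commute (_root_.tensorRight p A) (_root_.tensorRight p B) := by
  show kroneckerMap _ _ _ * kroneckerMap _ _ _ = kroneckerMap _ _ _ * kroneckerMap _ _ _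
  rw [← mul_kronecker_mul, ← mul_kronecker_mul, h.eq]

theorem exists_tensor_factorization {R : Type*} {X : S → Matrix n n ℂ} (hX : IsStarClosed X)
    {W : R → Matrix n n ℂ} (hW : IsStarClosed W) (hXW : ∀ s t, Commute (X s) (W t))
    [Nonempty n]
    (hirr : ∀ Z, (∀ s, Commute Z (X s)) → (∀ t, Commute Z (W t)) → ∃ c : ℂ, Z = c • 1) :
    ∃ (d : ℕ) (ι : Type) (_ : Fintype ι) (_ : DecidableEq ι) (V : Matrix n (Fin d × ι) ℂ)
      (Y : S → Matrix (Fin d) (Fin d) ℂ) (Z : R → Matrix ι ι ℂ),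
      IsUnitaryMat V ∧ (∀ s, X s * V = V * tensorLeft ι (Y s)) ∧
      (∀ t, W t * V = V * tensorRight (Fin d) (Z t)) ∧
      IsIrreducibleFamily Z := by
  obtain ⟨ι, _, _, d, C, Y, hC, hXC, hY⟩ := exists_irreducible_decomposition X hX
  obtain ⟨i₀⟩ : Nonempty ι := by
    by_contra h
    rw [not_nonempty_iff] at h
    have := hC.sum
    rw [Finset.univ_eq_empty, Finset.sum_empty] at this
    exact zero_ne_one this
  have hU : ∀ i, ∃ U : Matrix (Fin (d i)) (Fin (d i₀)) ℂ, Uᴴ * U = 1 ∧ U * Uᴴ = 1 ∧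
      ∀ s, U * Y i₀ s = Y i s * U := fun i => by
    obtain ⟨T, hT0, hT1, hT2⟩ := exists_ne_zero_intertwiner hX hW hXW hirr hC hXC hY i₀ i
    obtain rfl | ⟨c, hc, hc1, hc2⟩ := (hY i₀).intertwiner_eq_zero_or (hY i) hT1 hT2
    · exact absurd rfl hT0
    have hcc : (((√c)⁻¹ : ℝ) : ℂ) * (((√c)⁻¹ : ℝ) : ℂ) * (c : ℂ) = 1 := by
      rw [← Complex.ofReal_mul, ← Complex.ofReal_mul, ← mul_inv, Real.mul_self_sqrt hc.le,
        inv_mul_cancel₀ hc.ne', Complex.ofReal_one]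
    refine ⟨(((√c)⁻¹ : ℝ) : ℂ) • T, ?_, ?_, fun s => ?_⟩
    · rw [conjTranspose_smul, Matrix.smul_mul, Matrix.mul_smul, hc1, smul_smul, smul_smul,
        Complex.star_def, Complex.conj_ofReal, hcc, one_smul]
    · rw [conjTranspose_smul, Matrix.smul_mul, Matrix.mul_smul, hc2, smul_smul, smul_smul,
        Complex.star_def, Complex.conj_ofReal, hcc, one_smul]
    · rw [Matrix.smul_mul, Matrix.mul_smul, hT1]
  choose U hU1 hU2 hU3 using hU
  obtain ⟨D, hD⟩ : ∃ D : ι → Matrix n (Fin (d i₀)) ℂ, ∀ i, D i = C i * U i :=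
    ⟨_, fun _ => rfl⟩
  have hDD : ∀ i j, (D i)ᴴ * D j = if i = j then 1 else 0 := fun i j => by
    have h1 : (D i)ᴴ * D j = (U i)ᴴ * ((C i)ᴴ * C j) * U j := by
      simp only [hD, conjTranspose_mul, Matrix.mul_assoc]
    rw [h1]
    split_ifs with h
    · subst h; rw [hC.iso, Matrix.mul_one, hU1]
    · rw [hC.orth i j h, Matrix.mul_zero, Matrix.zero_mul]
  have hDsum : ∑ i, D i * (D i)ᴴ = 1 := by
    rw [← hC.sum]
    refine Finset.sum_congr rfl fun i _ => ?_
    calc _ = C i * (U i * (U i)ᴴ) * (C i)ᴴ := by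
          simp only [hD, conjTranspose_mul, Matrix.mul_assoc]
      _ = _ := by rw [hU2, Matrix.mul_one]
  have hXD : ∀ i s, X s * D i = D i * Y i₀ s := fun i s => by
    simp only [hD]
    rw [← Matrix.mul_assoc, hXC, Matrix.mul_assoc, ← hU3, Matrix.mul_assoc]
  have hDX : ∀ i s, (D i)ᴴ * X s = Y i₀ s * (D i)ᴴ := fun i s =>
    hX.conjTranspose_intertwines (by rw [hDD, if_pos rfl]) (hXD i) s
  have hz : ∀ t i j, ∃ z : ℂ, (D i)ᴴ * W t * D j = z • 1 := fun t i j => by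
    refine (hY i₀).2 _ fun s => ?_
    show (D i)ᴴ * W t * D j * Y i₀ s = Y i₀ s * ((D i)ᴴ * W t * D j)
    calc _ = (D i)ᴴ * (W t * X s) * D j := by
          rw [Matrix.mul_assoc, ← hXD]; simp only [Matrix.mul_assoc]
      _ = _ := by rw [← (hXW s t).eq, ← Matrix.mul_assoc, hDX]; simp only [Matrix.mul_assoc]
  choose z hz using hz
  set V : Matrix n (Fin (d i₀) × ι) ℂ := Matrix.of fun x p => D p.2 x p.1 with hV
  have hV1 : Vᴴ * V = 1 := by
    ext p q
    have h1 : (Vᴴ * V) p q = ((D p.2)ᴴ * D q.2) p.1 q.1 := rfl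
    rw [h1, hDD, Matrix.one_apply]
    by_cases h : p.2 = q.2
    · simp [h, Matrix.one_apply, Prod.ext_iff]
    · simp [h, Prod.ext_iff]
  have hV2 : V * Vᴴ = 1 := by
    rw [← hDsum]
    ext x y
    rw [Matrix.sum_apply, Matrix.mul_apply, Fintype.sum_prod_type_right]
    rfl
  have hXV : ∀ s, X s * V = V * tensorLeft ι (Y i₀ s) := fun s => by
    ext x p
    have h1 : (X s * V) x p = (X s * D p.2) x p.1 := rfl
    rw [h1, hXD]
    simp [Matrix.mul_apply, tensorLeft, kroneckerMap_apply, Fintype.sum_prod_type,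
      Matrix.one_apply, hV]
  have hWV : ∀ t, W t * V = V * tensorRight (Fin (d i₀)) (Matrix.of (z t)) := fun t => by
    ext x p
    have h1 : (W t * V) x p = (W t * D p.2) x p.1 := rfl
    have h2 : W t * D p.2 = ∑ i, z t i p.2 • D i := by
      calc W t * D p.2 = (∑ i, D i * (D i)ᴴ) * (W t * D p.2) := by rw [hDsum, Matrix.one_mul]
        _ = ∑ i, D i * ((D i)ᴴ * W t * D p.2) := by
          rw [Matrix.sum_mul]; simp only [Matrix.mul_assoc]
        _ = _ := by simp only [hz, Matrix.mul_smul, Matrix.mul_one]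
    rw [h1, h2]
    simp [Matrix.sum_apply, Matrix.mul_apply, tensorRight, kroneckerMap_apply,
      Fintype.sum_prod_type_right,
      Matrix.one_apply, hV, mul_comm]
  refine ⟨d i₀, ι, inferInstance, inferInstance, V, Y i₀, fun t => Matrix.of (z t), ⟨hV2, hV1⟩, hXV,
    hWV, ⟨i₀⟩, fun Q hQ => ?_⟩
  have hVX : ∀ s, Vᴴ * X s = tensorLeft ι (Y i₀ s) * Vᴴ := fun s =>
    hX.conjTranspose_intertwines hV1 hXV s
  have hVW : ∀ t, Vᴴ * W t = tensorRight (Fin (d i₀)) (Matrix.of (z t)) * Vᴴ := fun t =>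
    hW.conjTranspose_intertwines hV1 hWV t
  have hcomm : ∀ A B : Matrix (Fin (d i₀) × ι) (Fin (d i₀) × ι) ℂ, ∀ M : Matrix n n ℂ,
      M * V = V * B → Vᴴ * M = B * Vᴴ → Commute A B → Commute (V * A * Vᴴ) M := by
    intro A B M h1 h2 h
    show V * A * Vᴴ * M = M * (V * A * Vᴴ)
    rw [Matrix.mul_assoc, h2, ← Matrix.mul_assoc, Matrix.mul_assoc V, h.eq, ← Matrix.mul_assoc,
      ← Matrix.mul_assoc, ← Matrix.mul_assoc, h1]
  obtain ⟨c, hc⟩ := hirr (V * tensorRight (Fin (d i₀)) Q * Vᴴ)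
    (fun s => hcomm _ _ _ (hXV s) (hVX s) (commute_tensorRight_tensorLeft _ _))
    (fun t => hcomm _ _ _ (hWV t) (hVW t) (hQ t).tensorRight)
  refine ⟨c, ?_⟩
  obtain ⟨x⟩ := (hY i₀).1
  have h1 : tensorRight (Fin (d i₀)) Q = c • 1 := by
    calc tensorRight (Fin (d i₀)) Q
        = (Vᴴ * V) * tensorRight (Fin (d i₀)) Q * (Vᴴ * V) := by
          rw [hV1, Matrix.one_mul, Matrix.mul_one]
      _ = Vᴴ * (V * tensorRight (Fin (d i₀)) Q * Vᴴ) * V := by simp only [Matrix.mul_assoc]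
      _ = c • 1 := by rw [hc, Matrix.mul_smul, Matrix.mul_one, Matrix.smul_mul, hV1]
  ext i j
  have h2 := congrFun (congrFun h1 (x, i)) (x, j)
  simpa [tensorRight, kroneckerMap_apply, Matrix.one_apply, Matrix.smul_apply] using h2

end

/-- The operator `A` acting on the tensor factor `j`. -/
def tensorAt {k : ℕ} (m : Fin k → ℕ) (j : Fin k) (A : Matrix (Fin (m j)) (Fin (m j)) ℂ) :
    Matrix (∀ j, Fin (m j)) (∀ j, Fin (m j)) ℂ :=
  Matrix.of fun μ ν => if ∀ l, l ≠ j → μ l = ν l then A (μ j) (ν j) else 0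

theorem list_prod_tensorAt {k : ℕ} (m : Fin k → ℕ) (A : ∀ j, Matrix (Fin (m j)) (Fin (m j)) ℂ)
    (l : List (Fin k)) (hl : l.Nodup) (μ ν : ∀ j, Fin (m j)) :
    (l.map fun j => tensorAt m j (A j)).prod μ ν
      = if ∀ j, j ∉ l → μ j = ν j then (l.map fun j => A j (μ j) (ν j)).prod else 0 := by
  induction l generalizing μ with
  | nil => simp [Matrix.one_apply, funext_iff]
  | cons i l ih =>
    rw [List.nodup_cons] at hl
    rw [List.map_cons, List.prod_cons, Matrix.mul_apply]
    simp only [ih hl.2]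
    rw [Finset.sum_eq_single (Function.update μ i (ν i))]
    · have h1 : (∀ l, l ≠ i → μ l = Function.update μ i (ν i) l) :=
        fun l hl => by rw [Function.update_of_ne hl]
      have h2 : (l.map fun j => A j (Function.update μ i (ν i) j) (ν j))
          = l.map fun j => A j (μ j) (ν j) :=
        List.map_congr_left fun j hj => by
          have hji : j ≠ i := fun h => hl.1 (h ▸ hj)
          rw [Function.update_of_ne hji]
      have h3 : (∀ j, j ∉ l → Function.update μ i (ν i) j = ν j) ↔
          ∀ j, j ∉ i :: l → μ j = ν j := by
        refine forall_congr' fun j => ?_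
        by_cases hj : j = i
        · subst hj; simp
        · simp [hj]
      rw [h2, if_congr h3 rfl rfl, tensorAt, of_apply, if_pos h1, Function.update_self]
      simp
    · intro κ _ hκ
      rw [tensorAt, of_apply]
      split_ifs with h1 h2
      · refine absurd (funext fun j => ?_) hκ
        by_cases hj : j = i
        · subst hj; rw [Function.update_self, h2 j hl.1]
        · rw [Function.update_of_ne hj, h1 j hj]
      all_goals simp
    · simp

theorem prod_ofFn_tensorAt {k : ℕ} (m : Fin k → ℕ) (A : ∀ j, Matrix (Fin (m j)) (Fin (m j)) ℂ)
    (μ ν : ∀ j, Fin (m j)) :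
    (List.ofFn fun j => tensorAt m j (A j)).prod μ ν = ∏ j, A j (μ j) (ν j) := by
  rw [List.ofFn_eq_map, list_prod_tensorAt _ _ _ (List.nodup_finRange k),
    if_pos fun j hj => absurd (List.mem_finRange j) hj, ← List.ofFn_eq_map, List.prod_ofFn]

theorem tensorRight_mul (p : Type*) {q : Type*} [Fintype p] [DecidableEq p] [Fintype q]
    (A B : Matrix q q ℂ) : tensorRight p A * tensorRight p B = tensorRight p (A * B) := by
  show kroneckerMap _ _ _ * kroneckerMap _ _ _ = kroneckerMap _ _ _
  rw [← mul_kronecker_mul, Matrix.one_mul]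

theorem tensorRight_injective (p : Type*) {q : Type*} [DecidableEq p] [Nonempty p] :
    Function.Injective (tensorRight p : Matrix q q ℂ → _) := by
  intro A B h
  obtain ⟨x⟩ := ‹Nonempty p›
  ext i j
  simpa [tensorRight, kroneckerMap_apply] using congrFun (congrFun h (x, i)) (x, j)

theorem tensorRight_conjTranspose (p : Type*) {q : Type*} [DecidableEq p] (A : Matrix q q ℂ) :
    (tensorRight p A)ᴴ = tensorRight p Aᴴ := by
  show (kroneckerMap _ _ _)ᴴ = kroneckerMap _ _ _
  rw [conjTranspose_kronecker, conjTranspose_one]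

theorem tensorAt_zero {k : ℕ} (d : ℕ) (m : Fin k → ℕ) (A : Matrix (Fin d) (Fin d) ℂ) :
    tensorAt (Fin.cons d m : Fin (k + 1) → ℕ) 0 A
      = (tensorLeft (∀ j, Fin (m j)) A).submatrix
          (Fin.consEquiv fun j => Fin ((Fin.cons d m : Fin (k + 1) → ℕ) j)).symm
          (Fin.consEquiv fun j => Fin ((Fin.cons d m : Fin (k + 1) → ℕ) j)).symm := by
  ext μ ν
  show (if ∀ l, l ≠ 0 → μ l = ν l then A (μ 0) (ν 0) else 0)
    = A (μ 0) (ν 0) * (1 : Matrix (∀ j, Fin (m j)) (∀ j, Fin (m j)) ℂ) (Fin.tail μ) (Fin.tail ν)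
  have h : (∀ l, l ≠ 0 → μ l = ν l) ↔ (Fin.tail μ : ∀ j, Fin (m j)) = Fin.tail ν := by
    rw [funext_iff, Fin.forall_fin_succ]
    simp [Fin.tail]
  have h' : ∀ (x y : Fin d) (f g : ∀ j, Fin (m j)),
      (if f = g then A x y else 0) = A x y * (1 : Matrix _ _ ℂ) f g := fun x y f g => by
    rw [Matrix.one_apply, mul_ite, mul_one, mul_zero]
  exact (if_congr h rfl rfl).trans (h' (μ 0) (ν 0) (Fin.tail μ) (Fin.tail ν))

theorem tensorAt_succ {k : ℕ} (d : ℕ) (m : Fin k → ℕ) (j : Fin k)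
    (A : Matrix (Fin (m j)) (Fin (m j)) ℂ) :
    tensorAt (Fin.cons d m : Fin (k + 1) → ℕ) j.succ A
      = (tensorRight (Fin d) (tensorAt m j A)).submatrix
          (Fin.consEquiv fun j => Fin ((Fin.cons d m : Fin (k + 1) → ℕ) j)).symm
          (Fin.consEquiv fun j => Fin ((Fin.cons d m : Fin (k + 1) → ℕ) j)).symm := by
  ext μ ν
  show (if ∀ l, l ≠ j.succ → μ l = ν l then A (μ j.succ) (ν j.succ) else 0)
    = (1 : Matrix (Fin d) (Fin d) ℂ) (μ 0) (ν 0)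
      * (if ∀ l, l ≠ j → μ l.succ = ν l.succ then A (μ j.succ) (ν j.succ) else 0)
  have h : (∀ l, l ≠ j.succ → μ l = ν l) ↔
      ((μ 0 : Fin d) = ν 0 ∧ ∀ l, l ≠ j → μ l.succ = ν l.succ) := by
    rw [Fin.forall_fin_succ]
    simp [(Fin.succ_ne_zero _).symm]
  have h' : ∀ (x y : Fin d) (f g : ∀ j, Fin (m j)),
      (if x = y ∧ ∀ l, l ≠ j → f l = g l then A (f j) (g j) else 0) = (1 : Matrix _ _ ℂ) x y *
        (if ∀ l, l ≠ j → f l = g l then A (f j) (g j) else 0) := fun x y f g => by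
    rw [Matrix.one_apply, ite_and, ite_mul, one_mul, zero_mul]
  exact (if_congr h rfl rfl).trans (h' (μ 0) (ν 0) (Fin.tail μ) (Fin.tail ν))

theorem exists_tensor_product_form {k : ℕ} {S : Fin k → Type*} {n : Type} [Fintype n]
    [DecidableEq n] [Nonempty n] {X : ∀ j, S j → Matrix n n ℂ} (hX : ∀ j, IsStarClosed (X j))
    (hcomm : ∀ i j, i ≠ j → ∀ s t, Commute (X i s) (X j t))
    (hirr : ∀ Z, (∀ j s, Commute Z (X j s)) → ∃ c : ℂ, Z = c • 1) :
    ∃ (m : Fin k → ℕ) (V : Matrix n (∀ j, Fin (m j)) ℂ)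
      (Y : ∀ j, S j → Matrix (Fin (m j)) (Fin (m j)) ℂ),
      IsUnitaryMat V ∧ ∀ j s, X j s * V = V * tensorAt m j (Y j s) := by
  induction k generalizing n with
  | zero =>
    have hsub : Subsingleton n := ⟨fun x y => by
      by_contra hxy
      obtain ⟨c, hc⟩ := hirr (Matrix.single x y 1) nofun
      have h1 := congrFun (congrFun hc x) y
      simp [Matrix.smul_apply, Matrix.one_apply_ne hxy] at h1⟩
    refine ⟨nofun, Matrix.of fun _ _ => 1, nofun, ⟨?_, ?_⟩, nofun⟩
    · ext x y
      rw [Subsingleton.elim x y]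
      simp [Matrix.mul_apply]
    · obtain ⟨x⟩ := ‹Nonempty n›
      have : Unique n := ⟨⟨x⟩, fun y => Subsingleton.elim _ _⟩
      ext μ ν
      rw [Subsingleton.elim μ ν]
      simp [Matrix.mul_apply]
  | succ k ih =>
    obtain ⟨d, ι, _, _, V, Y, Z, ⟨hV2, hV1⟩, hXV, hWV, hZ⟩ :=
      exists_tensor_factorization (hX 0) (W := fun p : Σ j : Fin k, S j.succ => X p.1.succ p.2)
        (fun p => by
          obtain ⟨s', hs'⟩ := hX p.1.succ p.2
          exact ⟨⟨p.1, s'⟩, hs'⟩)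
        (fun s t => hcomm _ _ (Fin.succ_ne_zero _).symm _ _)
        (fun Z h0 h1 => hirr Z fun j => by
          refine Fin.cases ?_ ?_ j
          · exact h0
          · exact fun j s => h1 ⟨j, s⟩)
    have hd : Nonempty (Fin d) := by
      by_contra h
      rw [not_nonempty_iff] at h
      have : (0 : Matrix n n ℂ) = 1 := by
        rw [← hV2]; ext; simp [Matrix.mul_apply]
      exact zero_ne_one this
    have hmul : ∀ p q, X p.1.succ p.2 * X q.1.succ q.2 * V
        = V * tensorRight (Fin d) (Z p * Z q) := fun p q => by
      rw [Matrix.mul_assoc, hWV, ← Matrix.mul_assoc, hWV, Matrix.mul_assoc, tensorRight_mul]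
    have hcancel : ∀ A B : Matrix ι ι ℂ,
        V * tensorRight (Fin d) A = V * tensorRight (Fin d) B → A = B := fun A B h => by
      refine tensorRight_injective (Fin d) ?_
      have := congrArg (Vᴴ * ·) h
      simpa only [← Matrix.mul_assoc, hV1, Matrix.one_mul] using this
    have : Nonempty ι := hZ.1
    obtain ⟨m, V', Y', ⟨hV'2, hV'1⟩, hZV'⟩ := ih (X := fun j s => Z ⟨j, s⟩)
      (fun j s => by
        obtain ⟨s', hs'⟩ := (hX j.succ).compress hV1 (fun s => hWV ⟨j, s⟩) s
        rw [tensorRight_conjTranspose] at hs'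
        exact ⟨s', tensorRight_injective _ hs'⟩)
      (fun i j hij s t => hcancel _ _ (by
        rw [← hmul ⟨i, s⟩ ⟨j, t⟩, ← hmul ⟨j, t⟩ ⟨i, s⟩,
          (hcomm i.succ j.succ (fun h => hij (Fin.succ_injective _ h)) s t).eq]))
      (fun Q hQ => hZ.2 Q fun p => hQ p.1 p.2)
    let e : (∀ j, Fin ((Fin.cons d m : Fin (k + 1) → ℕ) j)) ≃ Fin d × ∀ j, Fin (m j) :=
      (Fin.consEquiv fun j => Fin ((Fin.cons d m : Fin (k + 1) → ℕ) j)).symm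
    let K : Matrix (Fin d × ι) (Fin d × ∀ j, Fin (m j)) ℂ := kroneckerMap (· * ·) 1 V'
    have hK1 : Kᴴ * K = 1 := by
      show (kroneckerMap _ _ _)ᴴ * kroneckerMap _ _ _ = 1
      rw [conjTranspose_kronecker, ← mul_kronecker_mul, hV'1]
      simp
    have hK2 : K * Kᴴ = 1 := by
      show kroneckerMap _ _ _ * (kroneckerMap _ _ _)ᴴ = 1
      rw [conjTranspose_kronecker, ← mul_kronecker_mul, hV'2]
      simp
    have hKL : ∀ A : Matrix (Fin d) (Fin d) ℂ,
        tensorLeft ι A * K = K * tensorLeft (∀ j, Fin (m j)) A := fun A => by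
      show kroneckerMap _ _ _ * kroneckerMap _ _ _ = kroneckerMap _ _ _ * kroneckerMap _ _ _
      rw [← mul_kronecker_mul, ← mul_kronecker_mul]
      simp only [Matrix.mul_one, Matrix.one_mul]
    have hKR : ∀ (A : Matrix ι ι ℂ) (B : Matrix (∀ j, Fin (m j)) (∀ j, Fin (m j)) ℂ),
        A * V' = V' * B →
        tensorRight (Fin d) A * K = K * tensorRight (Fin d) B := fun A B h => by
      show kroneckerMap _ _ _ * kroneckerMap _ _ _ = kroneckerMap _ _ _ * kroneckerMap _ _ _
      rw [← mul_kronecker_mul, ← mul_kronecker_mul, h]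
    have hkey : ∀ (M : Matrix n n ℂ) (A : Matrix (Fin d × ι) (Fin d × ι) ℂ)
        (B : Matrix (Fin d × ∀ j, Fin (m j)) (Fin d × ∀ j, Fin (m j)) ℂ),
        M * V = V * A → A * K = K * B →
        M * (V * K.submatrix id e) = V * K.submatrix id e * B.submatrix e e := by
      intro M A B h1 h2
      rw [← Matrix.mul_assoc, h1, Matrix.mul_assoc, Matrix.mul_assoc, submatrix_mul_equiv, ← h2]
      rfl
    refine ⟨Fin.cons d m, V * K.submatrix id e, Fin.cases Y Y', ⟨?_, ?_⟩, fun j => ?_⟩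
    · rw [conjTranspose_mul, conjTranspose_submatrix, Matrix.mul_assoc,
        ← Matrix.mul_assoc (K.submatrix id e), submatrix_mul_equiv, hK2, submatrix_id_id,
        Matrix.one_mul, hV2]
    · rw [conjTranspose_mul, conjTranspose_submatrix, Matrix.mul_assoc, ← Matrix.mul_assoc Vᴴ, hV1,
        Matrix.one_mul, ← submatrix_mul _ _ _ _ _ Function.bijective_id, hK1, submatrix_one_equiv]
    · refine Fin.cases (fun s => ?_) (fun j s => ?_) j
      · exact (hkey _ _ _ (hXV s) (hKL _)).trans
          (congrArg _ (tensorAt_zero d m (Y s)).symm)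
      · exact (hkey _ _ _ (hWV ⟨j, s⟩) (hKR _ _ (hZV' j s))).trans
          (congrArg _ (tensorAt_succ d m j (Y' j s)).symm)

theorem exists_block_tensor_decomposition {k : ℕ} {S : Fin k → Type*} {n : Type*} [Fintype n]
    [DecidableEq n] {X : ∀ j, S j → Matrix n n ℂ} (hX : ∀ j, IsStarClosed (X j))
    (hcomm : ∀ i j, i ≠ j → ∀ s t, Commute (X i s) (X j t)) :
    ∃ (ι : Type) (_ : Fintype ι) (_ : DecidableEq ι) (m : ι → Fin k → ℕ)
      (B : ∀ i, Matrix n (∀ j, Fin (m i j)) ℂ)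
      (Y : ∀ i j, S j → Matrix (Fin (m i j)) (Fin (m i j)) ℂ),
      IsOrthogonalDecomposition B ∧ (∀ i, Nonempty (∀ j, Fin (m i j))) ∧
      ∀ i j s, X j s * B i = B i * tensorAt (m i) j (Y i j s) := by
  have hX' : IsStarClosed fun p : Σ j, S j => X p.1 p.2 := fun p => by
    obtain ⟨s', hs'⟩ := hX p.1 p.2
    exact ⟨⟨p.1, s'⟩, hs'⟩
  obtain ⟨ι, _, _, d, C, Z, hC, hXC, hZ⟩ := exists_irreducible_decomposition _ hX'
  have hmul : ∀ i p q, X p.1 p.2 * X q.1 q.2 * C i = C i * (Z i p * Z i q) := fun i p q => by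
    rw [Matrix.mul_assoc, hXC, ← Matrix.mul_assoc, hXC, Matrix.mul_assoc]
  have hblock : ∀ i, ∃ (m : Fin k → ℕ) (V : Matrix (Fin (d i)) (∀ j, Fin (m j)) ℂ)
      (Y : ∀ j, S j → Matrix (Fin (m j)) (Fin (m j)) ℂ),
      IsUnitaryMat V ∧ ∀ j s, Z i ⟨j, s⟩ * V = V * tensorAt m j (Y j s) := fun i => by
    have := (hZ i).1
    refine exists_tensor_product_form (X := fun j s => Z i ⟨j, s⟩)
      (fun j => (hX j).compress (hC.iso i) fun s => hXC i ⟨j, s⟩) (fun p q hpq s t => ?_)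
      (fun Q hQ => (hZ i).2 Q fun p => hQ p.1 p.2)
    show _ * _ = _ * _
    have h1 := hmul i ⟨p, s⟩ ⟨q, t⟩
    rw [(hcomm p q hpq s t).eq, hmul i ⟨q, t⟩ ⟨p, s⟩] at h1
    have := congrArg ((C i)ᴴ * ·) h1
    simp only [← Matrix.mul_assoc, hC.iso, Matrix.one_mul] at this
    exact this.symm
  choose m V Y hV hZV using hblock
  have hBB : ∀ i j, (C i * V i)ᴴ * (C j * V j) = (V i)ᴴ * ((C i)ᴴ * C j) * V j := fun i j => by
    simp only [conjTranspose_mul, Matrix.mul_assoc]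
  refine ⟨ι, inferInstance, inferInstance, m, fun i => C i * V i, Y,
    ⟨fun i => ?_, fun i j hij => ?_, ?_⟩, fun i => ?_, fun i j s => ?_⟩
  · rw [hBB, hC.iso, Matrix.mul_one, (hV i).2]
  · rw [hBB, hC.orth i j hij, Matrix.mul_zero, Matrix.zero_mul]
  · rw [← hC.sum]
    refine Finset.sum_congr rfl fun i _ => ?_
    calc _ = C i * (V i * (V i)ᴴ) * (C i)ᴴ := by simp only [conjTranspose_mul, Matrix.mul_assoc]
      _ = _ := by rw [(hV i).1, Matrix.mul_one]
  · by_contra h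
    rw [not_nonempty_iff] at h
    have := (hZ i).1
    have h1 : (0 : Matrix (Fin (d i)) (Fin (d i)) ℂ) = 1 := by
      rw [← (hV i).1]; ext; simp [Matrix.mul_apply]
    exact zero_ne_one h1
  · rw [← Matrix.mul_assoc, hXC i ⟨j, s⟩, Matrix.mul_assoc, hZV, Matrix.mul_assoc]

section
variable {k : ℕ} {β : Fin k → Type*} {a : Type*}
  [∀ i, Fintype (β i)] [∀ i, DecidableEq (β i)] [∀ i, Nonempty (β i)]
  [Fintype a] [DecidableEq a] [Nonempty a]

theorem insertAt_same (i : Fin k) (x : β i) (g : ∀ j : {j : Fin k // j ≠ i}, β j.1) :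
    insertAt i x g i = x := by simp [insertAt]

theorem insertAt_ne (i : Fin k) (x : β i) (g : ∀ j : {j : Fin k // j ≠ i}, β j.1) {j : Fin k}
    (h : j ≠ i) : insertAt i x g j = g ⟨j, h⟩ := by simp [insertAt, h]

theorem insertAt_update (i : Fin k) (v : ∀ j, β j) (x : β i) :
    insertAt i x (fun j => v j.1) = Function.update v i x := by
  ext j
  by_cases h : j = i
  · subst h; simp [insertAt_same]
  · simp [insertAt_ne, h]

/-- Splitting off the output coordinate `i`. -/
def insertAtEquiv (i : Fin k) : (β i × ∀ j : {j : Fin k // j ≠ i}, β j.1) ≃ ∀ j, β j where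
  toFun p := insertAt i p.1 p.2
  invFun v := (v i, fun j => v j.1)
  left_inv p := by
    refine Prod.ext (insertAt_same ..) ?_
    ext j
    exact insertAt_ne _ _ _ j.2
  right_inv v := by
    show insertAt i (v i) (fun j => v j.1) = v
    rw [insertAt_update, Function.update_eq_self]

/-- The block of `ρ` indexed by two output values. -/
def slice {o n : Type*} (ρ : Matrix (o × n) (o × n) ℂ) (v w : o) : Matrix n n ℂ :=
  Matrix.of fun α α' => ρ (v, α) (w, α')

theorem slice_conjTranspose {o n : Type*} {ρ : Matrix (o × n) (o × n) ℂ} (hρ : ρ.IsHermitian)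
    (v w : o) : (slice ρ v w)ᴴ = slice ρ w v := by
  ext α α'
  exact hρ.apply _ _

theorem slice_extB_mul_extC {b c n : Type*} [Fintype b] [Fintype c] [Fintype n] [DecidableEq b]
    [DecidableEq c] (σ : Matrix (b × n) (b × n) ℂ) (τ : Matrix (c × n) (c × n) ℂ) (p q : b × c) :
    slice (extB σ * extC τ) p q = slice σ p.1 q.1 * slice τ p.2 q.2 := by
  ext α α'
  simp [slice, extB, extC, Matrix.mul_apply, Fintype.sum_prod_type]

theorem slice_eq_mul_of_qcmiOut_eq_zero {ρ : Matrix ((∀ j, β j) × a) ((∀ j, β j) × a) ℂ}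
    (hρ : ρ.PosSemidef) (hρ1 : ptrace₁ ρ = 1) (i : Fin k)
    (hcmi : qcmiOut i ((1 / (Fintype.card a : ℂ)) • ρ) = 0) (v w : ∀ j, β j) :
    slice ρ v w = slice (margOut i ρ) (v i) (w i) *
      slice (margRest i ρ) (fun j => v j.1) (fun j => w j.1) := by
  set r : ℝ := 1 / Fintype.card a with hr
  have hr0 : 0 < r := by positivity
  have hrc : (1 / (Fintype.card a : ℂ)) = (r : ℂ) := by simp [hr]
  have hrc0 : (r : ℂ) ≠ 0 := by exact_mod_cast hr0.ne'
  rw [hrc] at hcmi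
  set e : (β i × ∀ j : {j : Fin k // j ≠ i}, β j.1) × a ≃ (∀ j, β j) × a :=
    (insertAtEquiv i).prodCongr (Equiv.refl a)
  have hrp : ((r : ℂ) • ρ).PosSemidef := hρ.smul (by exact_mod_cast hr0.le)
  set ρ' := ((r : ℂ) • ρ).submatrix e e with hρ'
  have hp1 : ptrace₁ ρ' = ptrace₁ ((r : ℂ) • ρ) := by
    ext α α'
    exact Equiv.sum_comp (insertAtEquiv i) fun v => ((r : ℂ) • ρ) (v, α) (v, α')
  have hB : margB ρ' = margOut i ((r : ℂ) • ρ) := rfl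
  have hC : margC ρ' = margRest i ((r : ℂ) • ρ) := rfl
  have h1 : ptrace₁ ((r : ℂ) • ρ) = (r : ℂ) • 1 := by
    rw [← hρ1]; ext; simp [ptrace₁, Finset.mul_sum]
  have hq : qcmiBCA ρ' = 0 := by
    rw [← hcmi, qcmiBCA, qcmiOut, hB, hC, hp1, vNEntropy_submatrix hrp.isHermitian]
  have key := smul_eq_extB_mul_extC (hrp.submatrix e) hr0 (hp1.trans h1) hq
  have hO : margOut i ((r : ℂ) • ρ) = (r : ℂ) • margOut i ρ := by
    ext; simp [margOut, Finset.mul_sum]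
  have hR : margRest i ((r : ℂ) • ρ) = (r : ℂ) • margRest i ρ := by
    ext; simp [margRest, Finset.mul_sum]
  have key2 := congrArg (fun M => slice M ((insertAtEquiv i).symm v)
    ((insertAtEquiv i).symm w)) key
  simp only [slice_extB_mul_extC] at key2
  rw [← hρ', hB, hC, hO, hR] at key2
  have hs : slice ρ' ((insertAtEquiv i).symm v) ((insertAtEquiv i).symm w)
      = (r : ℂ) • slice ρ v w := by
    ext α α'
    show ((r : ℂ) • ρ) (insertAtEquiv i ((insertAtEquiv i).symm v), α)
      (insertAtEquiv i ((insertAtEquiv i).symm w), α') = _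
    rw [Equiv.apply_symm_apply, Equiv.apply_symm_apply]; rfl
  have hl : slice ((r : ℂ) • ρ') ((insertAtEquiv i).symm v) ((insertAtEquiv i).symm w)
        = (r : ℂ) • slice ρ' ((insertAtEquiv i).symm v) ((insertAtEquiv i).symm w) := rfl
  rw [hl, hs] at key2
  replace key2 : (r : ℂ) • (r : ℂ) • slice ρ v w
      = ((r : ℂ) • slice (margOut i ρ) (v i) (w i)) *
        ((r : ℂ) • slice (margRest i ρ) (fun j => v j.1) (fun j => w j.1)) := key2
  rw [Matrix.smul_mul, Matrix.mul_smul] at key2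
  exact smul_right_injective _ hrc0 (smul_right_injective _ hrc0 key2)

theorem nsmul_matrix_injective {m n : Type*} {c : ℕ} (hc : c ≠ 0) {A B : Matrix m n ℂ}
    (h : c • A = c • B) : A = B := by
  ext i j
  simpa [hc] using congrFun (congrFun h i) j

theorem sum_sum_update {ι R : Type*} [Fintype ι] [DecidableEq ι] {γ : ι → Type*}
    [∀ i, Fintype (γ i)] [AddCommMonoid R] (i : ι) (h : (∀ j, γ j) → R) :
    ∑ g, ∑ x, h (Function.update g i x) = Fintype.card (γ i) • ∑ g, h g := by
  have hφ : Function.Involutive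
      (fun p : (∀ j, γ j) × γ i => (Function.update p.1 i p.2, p.1 i)) := fun p => by simp
  have h1 : ∑ p : (∀ j, γ j) × γ i, h (Function.update p.1 i p.2)
      = ∑ p : (∀ j, γ j) × γ i, h p.1 := Equiv.sum_comp hφ.toPerm fun p => h p.1
  rw [Fintype.sum_prod_type, Fintype.sum_prod_type] at h1
  rw [h1]
  simp [Finset.smul_sum]

/-- Partial trace of a family of blocks over the output coordinate `i`. -/
def traceCoord {R : Type*} [AddCommMonoid R] (i : Fin k) (F : (∀ j, β j) → (∀ j, β j) → R)
    (v w : ∀ j, β j) : R :=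
  ∑ x, F (Function.update v i x) (Function.update w i x)

/-- Partial trace of a family of blocks over a list of output coordinates. -/
def traceCoords {R : Type*} [AddCommMonoid R] :
    List (Fin k) → ((∀ j, β j) → (∀ j, β j) → R) → (∀ j, β j) → (∀ j, β j) → R
  | [], F => F
  | i :: l, F => traceCoords l (traceCoord i F)

theorem sum_traceCoords {R : Type*} [AddCommMonoid R] (l : List (Fin k))
    (F : (∀ j, β j) → (∀ j, β j) → R) :
    ∑ z, traceCoords l F z z = (l.map fun i => Fintype.card (β i)).prod • ∑ z, F z z := by
  induction l generalizing F with
  | nil => simp [traceCoords]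
  | cons i l ih =>
    rw [traceCoords, ih, List.map_cons, List.prod_cons, mul_comm, mul_smul]
    congr 1
    exact sum_sum_update i fun z => F z z

theorem traceCoords_congr {R : Type*} [AddCommMonoid R] (l : List (Fin k))
    (F : (∀ j, β j) → (∀ j, β j) → R) (s : Set (Fin k))
    (hF : ∀ v w v' w' : ∀ j, β j, (∀ j ∉ s, v j = v' j) → (∀ j ∉ s, w j = w' j) →
      F v w = F v' w') {v w v' w' : ∀ j, β j}
    (hv : ∀ j ∉ s, j ∉ l → v j = v' j) (hw : ∀ j ∉ s, j ∉ l → w j = w' j) :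
    traceCoords l F v w = traceCoords l F v' w' := by
  induction l generalizing F s with
  | nil => exact hF _ _ _ _ (fun j hj => hv j hj (by simp)) (fun j hj => hw j hj (by simp))
  | cons i l ih =>
    refine ih (traceCoord i F) (insert i s) (fun v w v' w' h1 h2 => ?_) (fun j hj hjl => ?_)
      (fun j hj hjl => ?_)
    · refine Finset.sum_congr rfl fun x _ => hF _ _ _ _ (fun j hj => ?_) (fun j hj => ?_)
      all_goals
        by_cases hji : j = i
        · subst hji; simp
        · simp only [Function.update_of_ne hji]
          first | exact h1 j (by simp [hji, hj]) | exact h2 j (by simp [hji, hj])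
    · rw [Set.mem_insert_iff, not_or] at hj
      exact hv j hj.2 (by simp [hj.1, hjl])
    · rw [Set.mem_insert_iff, not_or] at hj
      exact hw j hj.2 (by simp [hj.1, hjl])

theorem eq_prod_mul_traceCoords {R : Type*} [Semiring R] (M : ∀ j, β j → β j → R)
    (l : List (Fin k)) (hl : l.Nodup) (F : (∀ j, β j) → (∀ j, β j) → R)
    (hF : ∀ i ∈ l, ∀ v w, F v w = M i (v i) (w i) * traceCoord i F v w) (v w : ∀ j, β j) :
    F v w = (l.map fun j => M j (v j) (w j)).prod * traceCoords l F v w := by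
  induction l generalizing F with
  | nil => simp [traceCoords]
  | cons i l ih =>
    rw [List.nodup_cons] at hl
    rw [List.map_cons, List.prod_cons, traceCoords, mul_assoc, ← ih hl.2]
    · exact hF i (by simp) v w
    · intro j hj v w
      have hji : j ≠ i := fun h => hl.1 (h ▸ hj)
      rw [traceCoord, Finset.sum_congr rfl fun x _ => hF j (by simp [hj]) _ _]
      simp only [Function.update_of_ne hji]
      rw [← Finset.mul_sum]
      congr 1
      simp only [traceCoord]
      rw [Finset.sum_comm]
      simp only [Function.update_comm hji]

theorem eq_prod_of_eq_mul_traceCoord {n : Type*} [Fintype n] [DecidableEq n]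
    (M : ∀ j, β j → β j → Matrix n n ℂ) (F : (∀ j, β j) → (∀ j, β j) → Matrix n n ℂ)
    (hF : ∀ i v w, F v w = M i (v i) (w i) * traceCoord i F v w) (hF1 : ∑ v, F v v = 1)
    (v w : ∀ j, β j) : F v w = (List.ofFn fun j => M j (v j) (w j)).prod := by
  have h1 := eq_prod_mul_traceCoords M (List.finRange k) (List.nodup_finRange k) F
    (fun i _ => hF i) v w
  have h2 := sum_traceCoords (List.finRange k) F
  have h3 : ∀ z, traceCoords (List.finRange k) F z z = traceCoords (List.finRange k) F v w :=
    fun z => traceCoords_congr _ F ∅ (fun v w v' w' h h' => by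
      rw [funext fun j => h j (Set.notMem_empty j), funext fun j => h' j (Set.notMem_empty j)])
      (fun j _ hj => absurd (List.mem_finRange j) hj)
      (fun j _ hj => absurd (List.mem_finRange j) hj)
  have h4 : ((List.finRange k).map fun i => Fintype.card (β i)).prod
      = Fintype.card (∀ j, β j) := by
    rw [Fintype.card_pi, ← List.ofFn_eq_map, List.prod_ofFn]
  rw [Finset.sum_congr rfl fun z _ => h3 z, Finset.sum_const, Finset.card_univ, hF1, h4] at h2
  have : Nonempty (∀ j, β j) := ⟨v⟩
  rw [nsmul_matrix_injective Fintype.card_ne_zero h2, mul_one] at h1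
  rw [h1, List.ofFn_eq_map]

theorem slice_margRest (ρ : Matrix ((∀ j, β j) × a) ((∀ j, β j) × a) ℂ) (i : Fin k)
    (v w : ∀ j, β j) : slice (margRest i ρ) (fun j => v j.1) (fun j => w j.1)
      = traceCoord i (slice ρ) v w := by
  ext α α'
  simp [slice, margRest, traceCoord, Matrix.sum_apply, insertAt_update]

theorem traceCoord_update {R : Type*} [AddCommMonoid R] (i : Fin k)
    (F : (∀ j, β j) → (∀ j, β j) → R) (v w : ∀ j, β j) (x y : β i) :
    traceCoord i F (Function.update v i x) (Function.update w i y) = traceCoord i F v w := by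
  simp [traceCoord]

theorem slice_margOut (ρ : Matrix ((∀ j, β j) × a) ((∀ j, β j) × a) ℂ) (i : Fin k) (x y : β i) :
    slice (margOut i ρ) x y = ∑ g, slice ρ (insertAt i x g) (insertAt i y g) := by
  ext α α'
  simp [slice, margOut, Matrix.sum_apply]

theorem update_insertAt {i j : Fin k} (h : i ≠ j) (x : β i) (y : β j)
    (g : ∀ l : {l : Fin k // l ≠ j}, β l.1) :
    Function.update (insertAt j y g) i x
      = insertAt j y (Function.update g ⟨i, h⟩ x) := by
  ext l
  by_cases hl : l = j
  · subst hl
    rw [Function.update_of_ne h.symm, insertAt_same, insertAt_same]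
  · rw [insertAt_ne _ _ _ hl]
    by_cases hi : l = i
    · subst hi; simp
    · rw [Function.update_of_ne hi, Function.update_of_ne (by simpa using hi), insertAt_ne _ _ _ hl]

theorem commute_slice_margOut {ρ : Matrix ((∀ j, β j) × a) ((∀ j, β j) × a) ℂ}
    (hρ : ρ.IsHermitian) (hF : ∀ i v w, slice ρ v w
      = slice (margOut i ρ) (v i) (w i) * traceCoord i (slice ρ) v w)
    {i j : Fin k} (hij : i ≠ j) (x x' : β i) (y y' : β j) :
    Commute (slice (margOut i ρ) x x') (slice (margOut j ρ) y y') := by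
  have hM : (margOut i ρ).IsHermitian := by
    ext p q
    simp [margOut, hρ.apply, Matrix.conjTranspose_apply]
  have hD : ∀ v w, (traceCoord i (slice ρ) v w)ᴴ = traceCoord i (slice ρ) w v := fun v w => by
    simp [traceCoord, conjTranspose_sum, slice_conjTranspose hρ]
  have hc : ∀ v w, Commute (slice (margOut i ρ) x x') (traceCoord i (slice ρ) v w) := fun v w => by
    have h1 := hF i (Function.update v i x) (Function.update w i x')
    have h2 := congrArg conjTranspose (hF i (Function.update w i x') (Function.update v i x))
    rw [conjTranspose_mul, slice_conjTranspose hρ, slice_conjTranspose hM, hD] at h2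
    rw [traceCoord_update, Function.update_self, Function.update_self] at h1 h2
    exact h1.symm.trans h2
  have h3 : ∑ g, traceCoord i (slice ρ) (insertAt j y g) (insertAt j y' g)
      = Fintype.card (β i) • slice (margOut j ρ) y y' := by
    simp only [traceCoord, update_insertAt hij]
    rw [slice_margOut]
    exact sum_sum_update (γ := fun l : {l : Fin k // l ≠ j} => β l.1) ⟨i, hij⟩
      fun g => slice ρ (insertAt j y g) (insertAt j y' g)
  have h4 : Commute (slice (margOut i ρ) x x') (Fintype.card (β i) • slice (margOut j ρ) y y') :=
    h3 ▸ Commute.sum_right _ _ _ fun g _ => hc _ _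
  have h5 : Fintype.card (β i) • (slice (margOut i ρ) x x' * slice (margOut j ρ) y y')
      = Fintype.card (β i) • (slice (margOut j ρ) y y' * slice (margOut i ρ) x x') := by
    rw [← mul_smul_comm, ← smul_mul_assoc]; exact h4
  have : Nonempty (β i) := ⟨x⟩
  exact nsmul_matrix_injective Fintype.card_ne_zero h5

theorem sum_slice_self {o n : Type*} [Fintype o] (M : Matrix (o × n) (o × n) ℂ) :
    ∑ v, slice M v v = ptrace₁ M := by
  ext x y
  simp [slice, ptrace₁, Matrix.sum_apply]

theorem ptrace₁_margOut (ρ : Matrix ((∀ j, β j) × a) ((∀ j, β j) × a) ℂ) (i : Fin k) :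
    ptrace₁ (margOut i ρ) = ptrace₁ ρ := by
  ext x y
  simp only [ptrace₁, margOut, of_apply]
  rw [← Fintype.sum_prod_type']
  exact Equiv.sum_comp (insertAtEquiv i) fun v => ρ (v, x) (v, y)

theorem margOut_posSemidef {ρ : Matrix ((∀ j, β j) × a) ((∀ j, β j) × a) ℂ} (hρ : ρ.PosSemidef)
    (i : Fin k) : (margOut i ρ).PosSemidef := by
  have : margOut i ρ = ∑ g, ρ.submatrix (fun p : β i × a => (insertAt i p.1 g, p.2))
      fun p => (insertAt i p.1 g, p.2) := by
    ext p q
    simp [margOut, Matrix.sum_apply]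
  rw [this]
  exact Matrix.posSemidef_sum _ fun g _ => hρ.submatrix _

/-- Compression of the input system of a channel operator along `C`. -/
def compressInput {b n m : Type*} [Fintype n] (M : Matrix (b × n) (b × n) ℂ) (C : Matrix n m ℂ) :
    Matrix (b × m) (b × m) ℂ :=
  Matrix.of fun p q => (Cᴴ * slice M p.1 q.1 * C) p.2 q.2

theorem compressInput_posSemidef {b n m : Type*} [Finite b] [Fintype n] [Finite m]
    {M : Matrix (b × n) (b × n) ℂ} (hM : M.PosSemidef) (C : Matrix n m ℂ) :
    (compressInput M C).PosSemidef := by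
  classical
  have := Fintype.ofFinite b
  have := Fintype.ofFinite m
  let K : Matrix (b × n) (b × m) ℂ := kroneckerMap (· * ·) 1 C
  have h : compressInput M C = Kᴴ * M * K := by
    ext ⟨x, p⟩ ⟨y, q⟩
    simp [compressInput, K, Matrix.mul_apply, Fintype.sum_prod_type, slice, Matrix.one_apply,
      kroneckerMap_apply, conjTranspose_apply, apply_ite, ite_mul]
  rw [h]
  exact hM.conjTranspose_mul_mul_same K

theorem ptrace₁_compressInput {b n m : Type*} [Fintype b] [Fintype n]
    (M : Matrix (b × n) (b × n) ℂ) (C : Matrix n m ℂ) :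
    ptrace₁ (compressInput M C) = Cᴴ * ptrace₁ M * C := by
  rw [← sum_slice_self M, Matrix.mul_sum, Matrix.sum_mul]
  ext p q
  simp [ptrace₁, compressInput, Matrix.sum_apply]

theorem list_prod_mul_eq_mul_list_prod {l : Type*} {n m : Type*} [Fintype n] [DecidableEq n]
    [Fintype m] [DecidableEq m] {X : l → Matrix n n ℂ} {Y : l → Matrix m m ℂ} {C : Matrix n m ℂ}
    (h : ∀ j, X j * C = C * Y j) (L : List l) :
    (L.map X).prod * C = C * (L.map Y).prod := by
  induction L with
  | nil => simp
  | cons j L ih =>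
    rw [List.map_cons, List.prod_cons, List.map_cons, List.prod_cons, Matrix.mul_assoc, ih,
      ← Matrix.mul_assoc, h, Matrix.mul_assoc]

theorem tensorAt_update {m : Fin k → ℕ} (j : Fin k) (A : Matrix (Fin (m j)) (Fin (m j)) ℂ)
    (μ : ∀ j, Fin (m j)) :
    (tensorAt m j A).submatrix (Function.update μ j) (Function.update μ j) = A := by
  ext x y
  have h : ∀ l, l ≠ j → Function.update μ j x l = Function.update μ j y l := fun l hl => by
    rw [Function.update_of_ne hl, Function.update_of_ne hl]
  rw [submatrix_apply, tensorAt, of_apply, if_pos h, Function.update_self, Function.update_self]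

theorem conjTranspose_submatrix_mul_mul {n m l : Type*} [Fintype n] (A : Matrix n n ℂ)
    (C : Matrix n m ℂ) (f : l → m) :
    (C.submatrix id f)ᴴ * A * C.submatrix id f = (Cᴴ * A * C).submatrix f f := by
  ext x y
  simp [Matrix.mul_apply]

theorem card_eq_of_isOrthogonalDecomposition {n : Type*} [Fintype n] [DecidableEq n] {ι : Type*}
    [Fintype ι] {d : ι → Type*} [∀ i, Fintype (d i)] [∀ i, DecidableEq (d i)]
    {C : ∀ i, Matrix n (d i) ℂ} (hC : IsOrthogonalDecomposition C) :
    ∑ i, Fintype.card (d i) = Fintype.card n := by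
  have h := congrArg Matrix.trace hC.sum
  rw [Matrix.trace_sum, Finset.sum_congr rfl fun i _ => Matrix.trace_mul_comm (C i) (C i)ᴴ] at h
  simp only [hC.iso, Matrix.trace_one] at h
  exact_mod_cast h

/-- The unitary assembled from an orthogonal decomposition. -/
def decompositionMatrix {n ι : Type*} {d : ι → Type*} (C : ∀ i, Matrix n (d i) ℂ) :
    Matrix (Σ i, d i) n ℂ :=
  Matrix.of fun p y => (C p.1)ᴴ p.2 y

theorem isUnitaryMat_decompositionMatrix {n : Type*} [Fintype n] [DecidableEq n] {ι : Type*}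
    [Fintype ι] [DecidableEq ι] {d : ι → Type*} [∀ i, Fintype (d i)] [∀ i, DecidableEq (d i)]
    {C : ∀ i, Matrix n (d i) ℂ} (hC : IsOrthogonalDecomposition C) :
    IsUnitaryMat (decompositionMatrix C) := by
  constructor
  · ext ⟨i, μ⟩ ⟨j, ν⟩
    have h : (decompositionMatrix C * (decompositionMatrix C)ᴴ) ⟨i, μ⟩ ⟨j, ν⟩
        = ((C i)ᴴ * C j) μ ν := by
      simp [decompositionMatrix, Matrix.mul_apply]
    rw [h]
    by_cases hij : i = j
    · subst hij
      simp [hC.iso, Matrix.one_apply]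
    · simp [hC.orth i j hij, hij]
  · rw [← hC.sum]
    ext x y
    simp [decompositionMatrix, Matrix.mul_apply, Matrix.sum_apply, Fintype.sum_sigma]

theorem conjOnA_decompositionMatrix {o n ι : Type*} [Fintype n] {d : ι → Type*}
    (ρ : Matrix (o × n) (o × n) ℂ) (C : ∀ i, Matrix n (d i) ℂ) (v w : o) (s t : Σ i, d i) :
    conjOnA ρ (decompositionMatrix C) (v, s) (w, t)
      = ((C s.1)ᴴ * slice ρ v w * C t.1) s.2 t.2 := by
  simp only [conjOnA, decompositionMatrix, slice, Matrix.mul_apply, of_apply, Finset.sum_mul,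
    conjTranspose_apply, star_star]
  exact Finset.sum_comm

theorem multiBlockForm_of_product_slices {ρ : Matrix ((∀ j, β j) × a) ((∀ j, β j) × a) ℂ}
    (hρ : ρ.PosSemidef) (hρ1 : ptrace₁ ρ = 1)
    (hcomm : ∀ i j, i ≠ j → ∀ (s : β i × β i) (t : β j × β j),
      Commute (slice (margOut i ρ) s.1 s.2) (slice (margOut j ρ) t.1 t.2))
    (hprod : ∀ v w, slice ρ v w = (List.ofFn fun j => slice (margOut j ρ) (v j) (w j)).prod) :
    Nonempty (MultiBlockForm ρ) := by
  have hM := fun j => margOut_posSemidef hρ j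
  obtain ⟨ι, _, _, m, B, Y, hB, hm, hXB⟩ := exists_block_tensor_decomposition
    (X := fun j (s : β j × β j) => slice (margOut j ρ) s.1 s.2)
    (fun j s => ⟨(s.2, s.1), (slice_conjTranspose (hM j).1 _ _).symm⟩) hcomm
  have hBl : ∀ i v w, slice ρ v w * B i
      = B i * (List.ofFn fun j => tensorAt (m i) j (Y i j (v j, w j))).prod := fun i v w => by
    rw [hprod, List.ofFn_eq_map, List.ofFn_eq_map]
    exact list_prod_mul_eq_mul_list_prod (fun j => hXB i j (v j, w j)) _
  let μ₀ := fun i => (hm i).some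
  let C : ∀ i j, Matrix a (Fin (m i j)) ℂ := fun i j =>
    (B i).submatrix id (Function.update (μ₀ i) j)
  have hC : ∀ i j, (C i j)ᴴ * C i j = 1 := fun i j => by
    have h := conjTranspose_submatrix_mul_mul 1 (B i) (Function.update (μ₀ i) j)
    rw [Matrix.mul_one, Matrix.mul_one, hB.iso,
      submatrix_one _ (Function.update_injective _ _)] at h
    exact h
  have hCY : ∀ i j x y, (C i j)ᴴ * slice (margOut j ρ) x y * C i j = Y i j (x, y) :=
    fun i j x y => by
      rw [conjTranspose_submatrix_mul_mul, ← compress_eq (hB.iso i) (hXB i j (x, y)),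
        tensorAt_update]
  refine ⟨⟨ι, m, ?_, decompositionMatrix B, isUnitaryMat_decompositionMatrix hB,
    fun i j => compressInput (margOut j ρ) (C i j),
    fun i j => ⟨compressInput_posSemidef (hM j) _, ?_⟩, fun v w s t hst => ?_,
    fun i μ ν v w => ?_⟩⟩
  · rw [← card_eq_of_isOrthogonalDecomposition hB]
    simp
  · rw [ptrace₁_compressInput, ptrace₁_margOut, hρ1, Matrix.mul_one, hC]
  · rw [conjOnA_decompositionMatrix, Matrix.mul_assoc, hBl, ← Matrix.mul_assoc,
      hB.orth _ _ hst, Matrix.zero_mul, Matrix.zero_apply]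
  · rw [conjOnA_decompositionMatrix, Matrix.mul_assoc, hBl, ← Matrix.mul_assoc, hB.iso,
      Matrix.one_mul, prod_ofFn_tensorAt]
    simp only [compressInput, of_apply, hCY]

/-- Theorem 4, 3 ⇒ 4: if each `I(B_i : B̄_i | A)` vanishes on the normalized channel
operator, then the channel admits a multipartite common-cause block form. -/
theorem cmi_zero_implies_multi_blockform
    (ρ : Matrix ((∀ j, β j) × a) ((∀ j, β j) × a) ℂ)
    (hρ : ρ.PosSemidef ∧ ptrace₁ ρ = 1)
    (hcmi : ∀ i : Fin k, qcmiOut i ((1 / (Fintype.card a : ℂ)) • ρ) = 0) :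
    Nonempty (MultiBlockForm ρ) := by
  have hF : ∀ i v w, slice ρ v w
      = slice (margOut i ρ) (v i) (w i) * traceCoord i (slice ρ) v w := fun i v w => by
    rw [← slice_margRest]
    exact slice_eq_mul_of_qcmiOut_eq_zero hρ.1 hρ.2 i (hcmi i) v w
  exact multiBlockForm_of_product_slices hρ.1 hρ.2
    (fun i j hij s t => commute_slice_margOut hρ.1.1 hF hij _ _ _ _)
    (eq_prod_of_eq_mul_traceCoord (fun j => slice (margOut j ρ)) _ hF
      ((sum_slice_self ρ).trans hρ.2))

end
end
end

section
/- Let ρ_{BC|A} be a CJ channel operator indexed by (b × c) × a that is diagonal, i.e. all its off-diagonal entries vanish. Define the classical channel P(β,γ|i) := the real part of ρ_{BC|A}(((β,γ),i),((β,γ),i)) (these diagonal entries are nonnegative reals summing over (β,γ) to 1 for each i). Then ρ_{BC|A} = ↑ρ_{B|A} · ↑ρ_{C|A} if and only if P(β,γ|i) = (Σ_{γ'} P(β,γ'|i)) · (Σ_{β'} P(β',γ|i)) for all i, β, γ; that is, the quantum conditional independence of the outputs given the input holds if and only if the classical channel defined by the diagonal entries has conditionally independent outputs given the input. -/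
open Matrix BigOperators
open scoped ComplexOrder

noncomputable section

theorem margB_diagonal {b c a : Type*} [Fintype c] [DecidableEq a] [DecidableEq b]
    [DecidableEq c] (d : (b × c) × a → ℂ) :
    margB (diagonal d) = diagonal fun p : b × a => ∑ γ, d ((p.1, γ), p.2) := by
  ext ⟨β, i⟩ ⟨β', i'⟩
  by_cases h : β = β' ∧ i = i'
  · obtain ⟨rfl, rfl⟩ := h
    simp [margB]
  · simp [margB, diagonal_apply, h]

theorem margC_diagonal {b c a : Type*} [Fintype b] [DecidableEq a] [DecidableEq b]
    [DecidableEq c] (d : (b × c) × a → ℂ) :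
    margC (diagonal d) = diagonal fun p : c × a => ∑ β, d ((β, p.1), p.2) := by
  ext ⟨γ, i⟩ ⟨γ', i'⟩
  by_cases h : γ = γ' ∧ i = i'
  · obtain ⟨rfl, rfl⟩ := h
    simp [margC]
  · simp [margC, diagonal_apply, h]

theorem extB_diagonal {b c a : Type*} [DecidableEq a] [DecidableEq b] [DecidableEq c]
    (d : b × a → ℂ) :
    extB (c := c) (diagonal d) = diagonal fun p : (b × c) × a => d (p.1.1, p.2) := by
  ext ⟨⟨β, γ⟩, i⟩ ⟨⟨β', γ'⟩, i'⟩
  simp only [extB, of_apply, diagonal_apply, Prod.mk.injEq]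
  grind

theorem extC_diagonal {b c a : Type*} [DecidableEq a] [DecidableEq b] [DecidableEq c]
    (d : c × a → ℂ) :
    extC (b := b) (diagonal d) = diagonal fun p : (b × c) × a => d (p.1.2, p.2) := by
  ext ⟨⟨β, γ⟩, i⟩ ⟨⟨β', γ'⟩, i'⟩
  simp only [extC, of_apply, diagonal_apply, Prod.mk.injEq]
  grind

/-- A diagonal channel operator `ρ_{BC|A}` satisfies the quantum conditional independence
condition `ρ_{BC|A} = ↑ρ_{B|A} · ↑ρ_{C|A}` if and only if the classical channel given by
its diagonal entries has conditionally independent outputs given the input. -/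
theorem diagonal_quantum_CI_iff_classical_CI
    {b c a : Type*} [Fintype b] [Fintype c] [Fintype a]
    [DecidableEq a] [DecidableEq b] [DecidableEq c]
    [Nonempty a] [Nonempty b] [Nonempty c]
    (ρ : Matrix ((b × c) × a) ((b × c) × a) ℂ)
    (hρ : IsCJChannel ρ)
    (hdiag : ∀ p q, p ≠ q → ρ p q = 0) :
    (ρ = extB (margB ρ) * extC (margC ρ)) ↔
      (∀ (i : a) (β : b) (γ : c),
        (ρ ((β, γ), i) ((β, γ), i)).re =
          (∑ γ' : c, (ρ ((β, γ'), i) ((β, γ'), i)).re) *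
            (∑ β' : b, (ρ ((β', γ), i) ((β', γ), i)).re)) := by
  obtain ⟨P, rfl⟩ : ∃ P : (b × c) × a → ℝ, ρ = diagonal fun p => (P p : ℂ) := by
    refine ⟨fun p => (ρ p p).re, ?_⟩
    ext p q
    by_cases h : p = q
    · subst h
      rw [diagonal_apply_eq]
      exact (hρ.1.isHermitian.coe_re_apply_self p).symm
    · rw [diagonal_apply_ne _ h, hdiag p q h]
  rw [margB_diagonal, margC_diagonal, extB_diagonal, extC_diagonal, diagonal_mul_diagonal,
    diagonal_injective.eq_iff, funext_iff]
  simp only [Prod.forall, diagonal_apply_eq, Complex.ofReal_re]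
  norm_cast
  exact ⟨fun h i β γ => h β γ i, fun h β γ i => h i β γ⟩

end
end

section
/- Let U be a unitary matrix with columns indexed by a × d and rows by b × c (so card a · card d = card b · card c), and let ρ_{BC|AD} := ρ^U be its CJ operator, viewed as a CJ channel operator from the composite input AD (index type a × d) to the two outputs B and C. Then ρ_{BC|AD} = ↑ρ_{B|AD} · ↑ρ_{C|AD}: for a unitary channel, the two output subsystems are quantum conditionally independent given the joint input. -/
open Matrix BigOperators
open scoped ComplexOrder

noncomputable section

/-- For a unitary channel from the composite input `AD` to outputs `B` and `C`, the two
outputs are quantum conditionally independent given the joint input. -/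
theorem unitary_channel_outputs_CI
    {b c a d : Type*} [Fintype b] [Fintype c] [Fintype a] [Fintype d]
    [DecidableEq a] [DecidableEq b] [DecidableEq c] [DecidableEq d]
    [Nonempty a] [Nonempty b] [Nonempty c] [Nonempty d]
    (hcard : Fintype.card a * Fintype.card d = Fintype.card b * Fintype.card c)
    (U : Matrix (b × c) (a × d) ℂ) (hU : IsUnitaryMat U) :
    cjOf U = extB (margB (cjOf U)) * extC (margC (cjOf U)) := by
  have h (y y' : b × c) : ∑ k, star (U y k) * U y' k = if y' = y then 1 else 0 := by
    have := congrFun (congrFun hU.1 y') y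
    simpa [Matrix.mul_apply, Matrix.one_apply, mul_comm] using this
  ext ⟨⟨b₁, c₁⟩, i⟩ ⟨⟨b₂, c₂⟩, i'⟩
  symm
  calc
    _ = ∑ k, (∑ γ, U (b₁, γ) i * star (U (b₂, γ) k)) *
          ∑ β, U (β, c₁) k * star (U (β, c₂) i') := by
        rw [Matrix.mul_apply, Fintype.sum_prod_type_right]
        refine Finset.sum_congr rfl fun k _ => ?_
        simp [extB, extC, margB, margC, cjOf, Fintype.sum_prod_type]
    _ = ∑ γ, ∑ β, U (b₁, γ) i * star (U (β, c₂) i') *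
          ∑ k, star (U (b₂, γ) k) * U (β, c₁) k := by
        simp_rw [Finset.sum_mul_sum, Finset.mul_sum]
        rw [Finset.sum_comm]
        refine Finset.sum_congr rfl fun γ _ => ?_
        rw [Finset.sum_comm]
        refine Finset.sum_congr rfl fun β _ => Finset.sum_congr rfl fun k _ => ?_
        ring
    _ = cjOf U ((b₁, c₁), i) ((b₂, c₂), i') := by
        simp_rw [h]
        simp [cjOf, ite_and]

end
end

section
/- Let a DAG on n nodes with finite node sets X i be given and let P be a joint distribution on Π i, X i that is Markov for the DAG. Let i ≠ j be two nodes that are ancestrally independent (their ancestor sets are disjoint). Then the joint marginal of (X i, X j) factorizes: for all y ∈ X i and z ∈ X j, P_{{i,j}}(y,z) = P_{{i}}(y) · P_{{j}}(z). (The qualitative part of Reichenbach's principle as a consequence of the Markov condition.) -/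
open BigOperators

noncomputable section

/-- The marginal `P_S(u)` of a joint distribution `P`: the sum of `P(x)` over those `x`
whose restriction to `S` equals `u`. -/
def margOn {n : ℕ} (X : Fin n → Type*) [∀ i, Fintype (X i)] [∀ i, DecidableEq (X i)]
    (P : (∀ i, X i) → ℝ) (S : Finset (Fin n)) (u : ∀ j : {j // j ∈ S}, X j.1) : ℝ :=
  ∑ x : ∀ i, X i, if ∀ j : {j // j ∈ S}, x j.1 = u j then P x else 0

/-- The conditional `P(x_i | x|Parents i)`, computed from `P`, with the convention that
division by zero yields `0` (which is the convention of real division). -/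
def condOn {n : ℕ} (Parents : Fin n → Finset (Fin n)) (X : Fin n → Type*)
    [∀ i, Fintype (X i)] [∀ i, DecidableEq (X i)]
    (P : (∀ i, X i) → ℝ) (i : Fin n) (x : ∀ i, X i) : ℝ :=
  margOn X P (insert i (Parents i)) (fun j => x j.1) /
    margOn X P (Parents i) (fun j => x j.1)

/-- `P` is Markov for the DAG: it factorizes as the product of the conditionals of each
node given its parents. -/
def IsMarkov {n : ℕ} (Parents : Fin n → Finset (Fin n)) (X : Fin n → Type*)
    [∀ i, Fintype (X i)] [∀ i, DecidableEq (X i)]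
    (P : (∀ i, X i) → ℝ) : Prop :=
  ∀ x, P x = ∏ i : Fin n, condOn Parents X P i x

/-- `P` is compatible with the DAG: it arises from independent latent variables and
deterministic functions of parents and latents. -/
structure DAGCompatible {n : ℕ} (Parents : Fin n → Finset (Fin n)) (X : Fin n → Type*)
    [∀ i, Fintype (X i)] [∀ i, DecidableEq (X i)]
    (P : (∀ i, X i) → ℝ) where
  Λ : Fin n → Type
  [fintΛ : ∀ i, Fintype (Λ i)]
  [nonemptyΛ : ∀ i, Nonempty (Λ i)]
  p : ∀ i, Λ i → ℝ
  p_nonneg : ∀ i l, 0 ≤ p i l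
  p_sum : ∀ i, ∑ l : Λ i, p i l = 1
  f : ∀ i, Λ i → (∀ j : {j // j ∈ Parents i}, X j.1) → X i
  eq : ∀ x, P x = ∑ lam : ∀ i, Λ i,
    (∏ i : Fin n, if x i = f i (lam i) (fun j => x j.1) then 1 else 0) *
      (∏ i : Fin n, p i (lam i))

/-- `j` is an ancestor of `i`: `j = i` or there is a directed path from `j` to `i`. -/
def IsAncestor {n : ℕ} (Parents : Fin n → Finset (Fin n)) (j i : Fin n) : Prop :=
  Relation.ReflTransGen (fun s t => s ∈ Parents t) j i

section FinitePi

variable {n : ℕ} {X : Fin n → Type*} [∀ i, Fintype (X i)]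

/-- Summing over one coordinate a second time multiplies the total by its cardinality. -/
theorem sum_sum_update_s17 (G : (∀ i, X i) → ℝ) (k : Fin n) :
    ∑ x : ∀ i, X i, ∑ a : X k, G (Function.update x k a) =
      Fintype.card (X k) * ∑ x : ∀ i, X i, G x := by
  rw [← Fintype.sum_prod_type' (f := fun x a => G (Function.update x k a))]
  have h : ∑ q : (∀ i, X i) × X k, G (Function.update q.1 k q.2) =
      ∑ q : (∀ i, X i) × X k, G q.1 := by
    refine Finset.sum_nbij' (fun q => (Function.update q.1 k q.2, q.1 k))
      (fun q => (Function.update q.1 k q.2, q.1 k)) ?_ ?_ ?_ ?_ ?_ <;> simp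
  rw [h, Fintype.sum_prod_type, Finset.mul_sum]
  simp

/-- A normalized kernel for a coordinate can be replaced by the uniform one against any
function that ignores this coordinate. -/
theorem sum_mul_kernel [∀ i, Nonempty (X i)] (F K : (∀ i, X i) → ℝ) (k : Fin n)
    (hF : ∀ x a, F (Function.update x k a) = F x)
    (hK : ∀ x, ∑ a : X k, K (Function.update x k a) = 1) :
    ∑ x, F x * K x = ∑ x, F x * (Fintype.card (X k) : ℝ)⁻¹ := by
  have hc : (Fintype.card (X k) : ℝ) ≠ 0 := by simp
  have h := sum_sum_update_s17 (fun x => F x * K x) k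
  simp only [hF, ← Finset.mul_sum, hK, mul_one] at h
  rw [← Finset.sum_mul, h]
  field_simp

/-- Functions of complementary sets of coordinates are independent under the counting measure. -/
theorem sum_mul_sum_of_dependsOn (F G : (∀ i, X i) → ℝ) (A : Finset (Fin n))
    (hF : ∀ x y, (∀ k ∈ A, x k = y k) → F x = F y)
    (hG : ∀ x y, (∀ k ∉ A, x k = y k) → G x = G y) :
    (∑ x, F x) * ∑ x, G x = Fintype.card (∀ i, X i) * ∑ x, F x * G x := by
  have h : ∑ q : (∀ i, X i) × (∀ i, X i), F q.1 * G q.2 =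
      ∑ q : (∀ i, X i) × (∀ i, X i), F q.1 * G q.1 := by
    refine Finset.sum_nbij' (fun q => (A.piecewise q.1 q.2, A.piecewise q.2 q.1))
      (fun q => (A.piecewise q.1 q.2, A.piecewise q.2 q.1)) ?_ ?_ ?_ ?_ ?_
    · simp
    · simp
    · rintro ⟨x, y⟩ -
      ext k <;> by_cases hk : k ∈ A <;> simp [hk]
    · rintro ⟨x, y⟩ -
      ext k <;> by_cases hk : k ∈ A <;> simp [hk]
    · rintro ⟨x, y⟩ -
      congr 1
      · exact hF _ _ fun k hk => by simp [hk]
      · exact hG _ _ fun k hk => by simp [hk]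
  rw [Finset.sum_mul_sum, ← Fintype.sum_prod_type' (f := fun x y => F x * G y), h,
    Fintype.sum_prod_type, Finset.mul_sum]
  simp

end FinitePi

/-- A family of conditional probability kernels along a DAG: each depends only on the node and
its parents, and is normalized. -/
structure IsKernelFamily {n : ℕ} (Parents : Fin n → Finset (Fin n)) (X : Fin n → Type*)
    [∀ i, Fintype (X i)] (K : Fin n → (∀ i, X i) → ℝ) : Prop where
  local_eq : ∀ k x y, (∀ l ∈ insert k (Parents k), x l = y l) → K k x = K k y
  sum_update : ∀ k x, ∑ a : X k, K k (Function.update x k a) = 1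

section Kernels

variable {n : ℕ} {Parents : Fin n → Finset (Fin n)} {X : Fin n → Type*} [∀ i, Fintype (X i)]
  [∀ i, Nonempty (X i)] {K : Fin n → (∀ i, X i) → ℝ}

theorem IsKernelFamily.sum_mul_prod_uniform_aux (hK : IsKernelFamily Parents X K)
    (hpar : ∀ i, ∀ j ∈ Parents i, j < i) (S : Finset (Fin n))
    (hS : ∀ k ∈ S, ∀ l ∈ Parents k, l ∈ S) (h : (∀ i, X i) → ℝ)
    (hh : ∀ x y, (∀ k ∈ S, x k = y k) → h x = h y) (T : Finset (Fin n)) :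
    (∀ k ∈ T, k ∉ S) → (∀ k ∈ T, ∀ l, k < l → l ∈ T ∨ l ∈ S) →
    ∑ x, h x * ∏ k, K k x =
      ∑ x, h x * ∏ k, if k ∈ T then (Fintype.card (X k) : ℝ)⁻¹ else K k x := by
  induction T using Finset.induction_on_min with
  | empty => simp
  | insert a s has ih =>
    intro hd hu
    have ha : a ∉ s := fun hm => (has a hm).false
    rw [ih (fun k hk => hd k (Finset.mem_insert_of_mem hk)) fun k hk l hl => by
      rcases hu k (Finset.mem_insert_of_mem hk) l hl with h1 | h1
      · rcases Finset.mem_insert.mp h1 with rfl | h2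
        · exact absurd hl (has k hk).asymm
        · exact Or.inl h2
      · exact Or.inr h1]
    have haS := hd a (Finset.mem_insert_self _ _)
    let F : (∀ i, X i) → ℝ := fun x => h x * ∏ k ∈ Finset.univ.erase a,
      if k ∈ s then (Fintype.card (X k) : ℝ)⁻¹ else K k x
    have key := sum_mul_kernel F (K a) a (fun x b => by
      have hne : ∀ l, l ≠ a → Function.update x a b l = x l := fun l hl => by simp [hl]
      refine congrArg₂ (· * ·) (hh _ _ fun k hk => hne k (by rintro rfl; exact haS hk))
        (Finset.prod_congr rfl fun k hk => ?_)
      have hka := Finset.ne_of_mem_erase hk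
      by_cases hks : k ∈ s
      · simp [hks]
      · simp only [hks, if_false]
        refine hK.local_eq k _ _ fun l hl => hne l ?_
        rintro rfl
        rcases Finset.mem_insert.mp hl with h1 | h1
        · exact hka h1.symm
        · rcases hu l (Finset.mem_insert_self _ _) k (hpar k l h1) with h2 | h2
          · exact (Finset.mem_insert.mp h2).elim hka hks
          · exact haS (hS k h2 l h1)) (hK.sum_update a)
    convert key using 2 with x _ x _
    · rw [← Finset.mul_prod_erase _ _ (Finset.mem_univ a), if_neg ha]
      simp only [F]; ring
    · rw [← Finset.mul_prod_erase _ _ (Finset.mem_univ a), if_pos (Finset.mem_insert_self _ _)]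
      have : ∀ k ∈ Finset.univ.erase a,
          (if k ∈ insert a s then (Fintype.card (X k) : ℝ)⁻¹ else K k x) =
            if k ∈ s then (Fintype.card (X k) : ℝ)⁻¹ else K k x := fun k hk => by
        simp [Finset.ne_of_mem_erase hk]
      rw [Finset.prod_congr rfl this]
      simp only [F]; ring

/-- Kernels outside an ancestral set do not affect expectations of functions on that set. -/
theorem IsKernelFamily.sum_mul_prod_uniform (hK : IsKernelFamily Parents X K)
    (hpar : ∀ i, ∀ j ∈ Parents i, j < i) (S : Finset (Fin n))
    (hS : ∀ k ∈ S, ∀ l ∈ Parents k, l ∈ S) (h : (∀ i, X i) → ℝ)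
    (hh : ∀ x y, (∀ k ∈ S, x k = y k) → h x = h y) :
    ∑ x, h x * ∏ k, K k x =
      ∑ x, h x * ∏ k, if k ∈ S then K k x else (Fintype.card (X k) : ℝ)⁻¹ := by
  rw [hK.sum_mul_prod_uniform_aux hpar S hS h hh Sᶜ (by simp)
    fun k _ l _ => by by_cases hl : l ∈ S <;> simp [hl]]
  refine Finset.sum_congr rfl fun x _ => congrArg _ (Finset.prod_congr rfl fun k _ => ?_)
  by_cases hk : k ∈ S <;> simp [hk]

theorem IsKernelFamily.sum_prod (hK : IsKernelFamily Parents X K)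
    (hpar : ∀ i, ∀ j ∈ Parents i, j < i) : ∑ x, ∏ k, K k x = 1 := by
  have h := hK.sum_mul_prod_uniform hpar ∅ (by simp) (fun _ => 1) (fun _ _ _ => rfl)
  simp only [one_mul] at h
  rw [h]
  have : ∏ k, (Fintype.card (X k) : ℝ) ≠ 0 := Finset.prod_ne_zero_iff.mpr fun k _ => by simp
  simp [Fintype.card_pi, Finset.prod_inv_distrib, this]

/-- Functions on disjoint ancestral sets are uncorrelated under a product of kernels. -/
theorem IsKernelFamily.sum_mul_mul_prod (hK : IsKernelFamily Parents X K)
    (hpar : ∀ i, ∀ j ∈ Parents i, j < i) (A B : Finset (Fin n)) (hAB : Disjoint A B)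
    (hA : ∀ k ∈ A, ∀ l ∈ Parents k, l ∈ A) (hB : ∀ k ∈ B, ∀ l ∈ Parents k, l ∈ B)
    (f g : (∀ i, X i) → ℝ) (hf : ∀ x y, (∀ k ∈ A, x k = y k) → f x = f y)
    (hg : ∀ x y, (∀ k ∈ B, x k = y k) → g x = g y) :
    ∑ x, f x * g x * ∏ k, K k x =
      (∑ x, f x * ∏ k, K k x) * ∑ x, g x * ∏ k, K k x := by
  let L : Fin n → (∀ i, X i) → ℝ := fun k x =>
    if k ∈ A ∪ B then K k x else (Fintype.card (X k) : ℝ)⁻¹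
  have hS : ∀ k ∈ A ∪ B, ∀ l ∈ Parents k, l ∈ A ∪ B := fun k hk l hl =>
    Finset.mem_union.mpr ((Finset.mem_union.mp hk).imp (hA k · l hl) (hB k · l hl))
  have hKL : ∀ h : (∀ i, X i) → ℝ, (∀ x y, (∀ k ∈ A ∪ B, x k = y k) → h x = h y) →
      ∑ x, h x * ∏ k, K k x = ∑ x, h x * ∏ k, L k x :=
    hK.sum_mul_prod_uniform hpar _ hS
  have hf' : ∀ x y, (∀ k ∈ A ∪ B, x k = y k) → f x = f y := fun x y hxy =>
    hf x y fun k hk => hxy k (Finset.mem_union_left _ hk)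
  have hg' : ∀ x y, (∀ k ∈ A ∪ B, x k = y k) → g x = g y := fun x y hxy =>
    hg x y fun k hk => hxy k (Finset.mem_union_right _ hk)
  have h1 : ∑ x, ∏ k, L k x = 1 := by
    have := hKL (fun _ => 1) fun _ _ _ => rfl
    simp only [one_mul] at this
    rw [← this, hK.sum_prod hpar]
  rw [hKL _ hf', hKL _ hg', hKL (fun x => f x * g x) fun x y hxy => by
    rw [hf' x y hxy, hg' x y hxy]]
  let F : (∀ i, X i) → ℝ := fun x => ∏ k ∈ A, L k x
  let G : (∀ i, X i) → ℝ := fun x => ∏ k ∈ Aᶜ, L k x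
  have hFG : ∀ x, ∏ k, L k x = F x * G x := fun x => (Finset.prod_mul_prod_compl A _).symm
  have hF : ∀ x y, (∀ k ∈ A, x k = y k) → F x = F y := fun x y hxy =>
    Finset.prod_congr rfl fun k hk => by
      simp only [L, Finset.mem_union_left B hk, if_true]
      exact hK.local_eq k x y fun l hl => hxy l
        ((Finset.mem_insert.mp hl).elim (fun e => e ▸ hk) (hA k hk l))
  have hG : ∀ x y, (∀ k ∉ A, x k = y k) → G x = G y := fun x y hxy =>
    Finset.prod_congr rfl fun k hk => by
      by_cases hkB : k ∈ B
      · simp only [L, Finset.mem_union_right A hkB, if_true]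
        exact hK.local_eq k x y fun l hl => hxy l fun hlA => Finset.disjoint_left.mp hAB hlA
          ((Finset.mem_insert.mp hl).elim (fun e => e ▸ hkB) (hB k hkB l))
      · simp only [L, Finset.mem_union, Finset.mem_compl.mp hk, hkB, or_self, if_false]
  have hgA : ∀ x y, (∀ k ∉ A, x k = y k) → g x = g y := fun x y hxy =>
    hg x y fun k hk => hxy k (Finset.disjoint_right.mp hAB hk)
  have hfF : ∀ x y, (∀ k ∈ A, x k = y k) → f x * F x = f y * F y := fun x y hxy => by
    rw [hf x y hxy, hF x y hxy]
  have hgG : ∀ x y, (∀ k ∉ A, x k = y k) → g x * G x = g y * G y := fun x y hxy => by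
    rw [hgA x y hxy, hG x y hxy]
  have e1 := sum_mul_sum_of_dependsOn F G A hF hG
  have e2 := sum_mul_sum_of_dependsOn _ G A hfF hG
  have e3 := sum_mul_sum_of_dependsOn F _ A hF hgG
  have e4 := sum_mul_sum_of_dependsOn _ _ A hfF hgG
  have r2 : ∑ x, f x * ∏ k, L k x = ∑ x, f x * F x * G x :=
    Finset.sum_congr rfl fun x _ => by rw [hFG]; ring
  have r3 : ∑ x, g x * ∏ k, L k x = ∑ x, F x * (g x * G x) :=
    Finset.sum_congr rfl fun x _ => by rw [hFG]; ring
  have r4 : ∑ x, f x * g x * ∏ k, L k x = ∑ x, f x * F x * (g x * G x) :=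
    Finset.sum_congr rfl fun x _ => by rw [hFG]; ring
  simp only [hFG] at h1
  rw [h1, mul_one] at e1
  rw [r2, r3, r4]
  have hN : (Fintype.card (∀ i, X i) : ℝ) ≠ 0 :=
    Nat.cast_ne_zero.mpr Fintype.card_ne_zero
  refine mul_left_cancel₀ hN (mul_left_cancel₀ hN ?_)
  calc _ = (Fintype.card (∀ i, X i) : ℝ) * ((∑ x, f x * F x) * ∑ x, g x * G x) := by rw [e4]
    _ = ((∑ x, f x * F x) * ∑ x, G x) * ((∑ x, F x) * ∑ x, g x * G x) := by rw [← e1]; ring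
    _ = _ := by rw [e2, e3]; ring

end Kernels

section Markov

variable {n : ℕ} (Parents : Fin n → Finset (Fin n)) (X : Fin n → Type*) [∀ i, Fintype (X i)]
  [∀ i, DecidableEq (X i)] (P : (∀ i, X i) → ℝ)

/-- The conditional of a node given its parents, completed by the uniform distribution where
the marginal of the parents vanishes. -/
def completedCond (k : Fin n) (x : ∀ i, X i) : ℝ :=
  if margOn X P (Parents k) (fun j => x j.1) = 0 then (Fintype.card (X k) : ℝ)⁻¹
  else condOn Parents X P k x

variable {Parents X P}

theorem margOn_nonneg (hP0 : ∀ x, 0 ≤ P x) (S : Finset (Fin n))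
    (u : ∀ j : {j // j ∈ S}, X j.1) : 0 ≤ margOn X P S u :=
  Finset.sum_nonneg fun x _ => by split_ifs <;> simp [hP0]

theorem margOn_restrict_congr (S : Finset (Fin n)) {x y : ∀ i, X i}
    (h : ∀ k ∈ S, x k = y k) :
    margOn X P S (fun j => x j.1) = margOn X P S (fun j => y j.1) :=
  congrArg _ (funext fun j => h j.1 j.2)

theorem sum_margOn_insert_update (S : Finset (Fin n)) {k : Fin n} (hk : k ∉ S)
    (x : ∀ i, X i) :
    ∑ a : X k, margOn X P (insert k S) (fun j => Function.update x k a j.1) =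
      margOn X P S (fun j => x j.1) := by
  unfold margOn
  rw [Finset.sum_comm]
  refine Finset.sum_congr rfl fun w _ => ?_
  have hiff : ∀ a : X k, (∀ j : {j // j ∈ insert k S}, w j.1 = Function.update x k a j.1) ↔
      w k = a ∧ ∀ j : {j // j ∈ S}, w j.1 = x j.1 := fun a => by
    have hne : ∀ l ∈ S, Function.update x k a l = x l := fun l hl =>
      Function.update_of_ne (ne_of_mem_of_not_mem hl hk) _ _
    constructor
    · intro h
      exact ⟨by simpa using h ⟨k, Finset.mem_insert_self _ _⟩, fun j =>
        (h ⟨j.1, Finset.mem_insert_of_mem j.2⟩).trans (hne j.1 j.2)⟩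
    · rintro ⟨h1, h2⟩ ⟨l, hl⟩
      rcases Finset.mem_insert.mp hl with rfl | hl
      · simpa using h1
      · exact (h2 ⟨l, hl⟩).trans (hne l hl).symm
  simp only [hiff, ite_and]
  simp

theorem isKernelFamily_completedCond [∀ i, Nonempty (X i)]
    (hpar : ∀ i, ∀ j ∈ Parents i, j < i) :
    IsKernelFamily Parents X (completedCond Parents X P) where
  local_eq k x y h := by
    unfold completedCond condOn
    rw [margOn_restrict_congr _ h,
      margOn_restrict_congr _ fun l hl => h l (Finset.mem_insert_of_mem hl)]
  sum_update k x := by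
    have hk : k ∉ Parents k := fun h => (hpar k k h).false
    have hm : ∀ a : X k, margOn X P (Parents k) (fun j => Function.update x k a j.1) =
        margOn X P (Parents k) (fun j => x j.1) := fun a =>
      margOn_restrict_congr _ fun l hl =>
        Function.update_of_ne (ne_of_mem_of_not_mem hl hk) _ _
    unfold completedCond condOn
    simp only [hm]
    split_ifs with h0
    · simp
    · rw [← Finset.sum_div, sum_margOn_insert_update _ hk, div_self h0]

/-- A Markov distribution is the product of its completed conditionals. -/
theorem IsMarkov.eq_prod_completedCond [∀ i, Nonempty (X i)] (hm : IsMarkov Parents X P)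
    (hpar : ∀ i, ∀ j ∈ Parents i, j < i) (hP0 : ∀ x, 0 ≤ P x) (hP1 : ∑ x, P x = 1)
    (x : ∀ i, X i) : P x = ∏ k, completedCond Parents X P k x := by
  have hle : ∀ x ∈ Finset.univ, P x ≤ ∏ k, completedCond Parents X P k x := fun x _ => by
    rw [hm x]
    refine Finset.prod_le_prod
      (fun k _ => div_nonneg (margOn_nonneg hP0 _ _) (margOn_nonneg hP0 _ _)) fun k _ => ?_
    unfold completedCond
    split_ifs with h0
    · simp [condOn, h0]
    · exact le_rfl
  refine (Finset.sum_eq_sum_iff_of_le hle).mp ?_ x (Finset.mem_univ x)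
  rw [hP1, (isKernelFamily_completedCond hpar).sum_prod hpar]

end Markov

/-- Qualitative Reichenbach principle from the Markov condition: if `P` is Markov for a
DAG and nodes `i ≠ j` are ancestrally independent, then the joint marginal on `{i, j}`
factorizes as the product of the single-node marginals. -/
theorem markov_ancestral_independence_implies_factorization
    {n : ℕ} (Parents : Fin n → Finset (Fin n))
    (hpar : ∀ i, ∀ j ∈ Parents i, j < i)
    (X : Fin n → Type*) [∀ i, Fintype (X i)] [∀ i, DecidableEq (X i)]
    [∀ i, Nonempty (X i)]
    (P : (∀ i, X i) → ℝ)
    (hP0 : ∀ x, 0 ≤ P x) (hP1 : ∑ x : ∀ i, X i, P x = 1)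
    (hm : IsMarkov Parents X P)
    (i j : Fin n) (hij : i ≠ j)
    (hanc : ∀ s : Fin n, IsAncestor Parents s i → IsAncestor Parents s j → False) :
    ∀ (y : X i) (z : X j),
      margOn X P ({i, j} : Finset (Fin n)) (fun kk =>
        if h : kk.1 = i then cast (congrArg X h).symm y
        else cast (congrArg X
          (Finset.mem_singleton.mp ((Finset.mem_insert.mp kk.2).resolve_left h))).symm z) =
      margOn X P ({i} : Finset (Fin n)) (fun kk =>
        cast (congrArg X (Finset.mem_singleton.mp kk.2)).symm y) *
      margOn X P ({j} : Finset (Fin n)) (fun kk =>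
        cast (congrArg X (Finset.mem_singleton.mp kk.2)).symm z) := by
  classical
  intro y z
  have hP := hm.eq_prod_completedCond hpar hP0 hP1
  let A : Fin n → Finset (Fin n) := fun t => Finset.univ.filter fun s => IsAncestor Parents s t
  have hA : ∀ t, ∀ k ∈ A t, ∀ l ∈ Parents k, l ∈ A t := fun t k hk l hl => by
    simp only [A, Finset.mem_filter, Finset.mem_univ, true_and] at hk ⊢
    exact Relation.ReflTransGen.head hl hk
  have hself : ∀ t, t ∈ A t := fun t => by
    simp only [A, Finset.mem_filter, Finset.mem_univ, true_and]
    exact Relation.ReflTransGen.refl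
  have hdisj : Disjoint (A i) (A j) := Finset.disjoint_left.mpr fun s hi hj =>
    hanc s (Finset.mem_filter.mp hi).2 (Finset.mem_filter.mp hj).2
  have key := (isKernelFamily_completedCond (P := P) hpar).sum_mul_mul_prod hpar (A i) (A j) hdisj
    (hA i) (hA j) (fun x => if x i = y then 1 else 0) (fun x => if x j = z then 1 else 0)
    (fun x x' h => by simp only [h i (hself i)]) (fun x x' h => by simp only [h j (hself j)])
  simp only [← hP] at key
  have hsingle : ∀ (t : Fin n) (y : X t) (x : ∀ k, X k),
      (∀ kk : {k // k ∈ ({t} : Finset (Fin n))}, x kk.1 =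
        cast (congrArg X (Finset.mem_singleton.mp kk.2)).symm y) ↔ x t = y := by
    refine fun t y x => ⟨fun h => by simpa using h ⟨t, by simp⟩, ?_⟩
    rintro h ⟨k, hk⟩
    obtain rfl := Finset.mem_singleton.mp hk
    simpa using h
  unfold margOn
  convert key using 2
  · rename_i x _
    have hiff : (∀ kk : {k // k ∈ ({i, j} : Finset (Fin n))}, x kk.1 =
        if h : kk.1 = i then cast (congrArg X h).symm y
        else cast (congrArg X
          (Finset.mem_singleton.mp ((Finset.mem_insert.mp kk.2).resolve_left h))).symm z) ↔
        x i = y ∧ x j = z := by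
      constructor
      · intro h
        have h1 := h ⟨i, by simp⟩
        have h2 := h ⟨j, by simp⟩
        simp only [hij.symm, dite_true, dite_false, cast_eq] at h1 h2
        exact ⟨h1, h2⟩
      · rintro ⟨h1, h2⟩ ⟨k, hk⟩
        rcases Finset.mem_insert.mp hk with rfl | hk
        · simp [h1]
        · obtain rfl := Finset.mem_singleton.mp hk
          simp [hij.symm, h2]
    rw [if_congr hiff rfl rfl]
    by_cases h1 : x i = y <;> by_cases h2 : x j = z <;> simp [h1, h2]
  · refine Finset.sum_congr rfl fun x _ => ?_
    rw [if_congr (hsingle i y x) rfl rfl, ite_mul, one_mul, zero_mul]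
  · refine Finset.sum_congr rfl fun x _ => ?_
    rw [if_congr (hsingle j z x) rfl rfl, ite_mul, one_mul, zero_mul]

end
end
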